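/- Suppose ρ₁ ≠ ρ₂ and c'' = c/(ρ₁⁻¹ − ρ₂⁻¹) ∈ E_a. If μ_{M̃,D̃} is a spectral measure, then ρ₁⁻¹ and ρ₂⁻¹ are integers divisible by p. -/

import Mathlib

open MeasureTheory Complex Matrix
open scoped ENNReal

noncomputable section

/-- The exponential function `e_λ(x) = e^{-2πi⟨λ,x⟩}` on `ℝ²`. -/
def expChar (lam x : Fin 2 → ℝ) : ℂ :=
  Complex.exp ((-2 * Real.pi * Complex.I) * ((lam 0 * x 0 + lam 1 * x 1 : ℝ) : ℂ))

/-- The Fourier transform `μ̂(ξ) = ∫ e^{-2πi⟨ξ,x⟩} dμ(x)` of a measure on `ℝ²`. -/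
def ftMeasure (μ : Measure (Fin 2 → ℝ)) (ξ : Fin 2 → ℝ) : ℂ :=
  ∫ x, expChar ξ x ∂μ

/-- The mask `m_D(ξ) = (1/p) Σ_{d∈D} e^{-2πi⟨ξ,d⟩}` of a digit system `D : Fin p → ℝ²`. -/
def mask {p : ℕ} (D : Fin p → (Fin 2 → ℝ)) (ξ : Fin 2 → ℝ) : ℂ :=
  (p : ℂ)⁻¹ * ∑ i : Fin p, expChar ξ (D i)

/-- Integer digits, coerced to real vectors. -/
def digitR {p : ℕ} (D : Fin p → (Fin 2 → ℤ)) : Fin p → (Fin 2 → ℝ) :=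
  fun i j => (D i j : ℝ)

/-- `μ` is the self-affine measure of the IFS `φ_d(x) = M⁻¹(x+d)`, `d ∈ D`:
a compactly supported Borel probability measure with `μ = (1/#D) Σ_d μ ∘ φ_d⁻¹`. -/
def IsSelfAffine {p : ℕ} (μ : Measure (Fin 2 → ℝ)) (M : Matrix (Fin 2) (Fin 2) ℝ)
    (D : Fin p → (Fin 2 → ℝ)) : Prop :=
  IsProbabilityMeasure μ ∧ (∃ K : Set (Fin 2 → ℝ), IsCompact K ∧ μ Kᶜ = 0) ∧
  μ = (p : ℝ≥0∞)⁻¹ • ∑ i : Fin p, μ.map (fun x => M⁻¹.mulVec (x + D i))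

/-- `Λ` is an orthogonal set of exponentials for `μ`. -/
def IsOrthoSet (μ : Measure (Fin 2 → ℝ)) (Λ : Set (Fin 2 → ℝ)) : Prop :=
  ∀ l ∈ Λ, ∀ l' ∈ Λ, l ≠ l' → ftMeasure μ (l - l') = 0

/-- `μ` is a spectral measure: some countable set of exponentials forms an
orthonormal (Hilbert) basis of `L²(μ)`. -/
def IsSpectral (μ : Measure (Fin 2 → ℝ)) : Prop :=
  ∃ Λ : Set (Fin 2 → ℝ), Λ.Countable ∧
    ∃ b : HilbertBasis Λ ℂ (Lp ℂ 2 μ),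
      ∀ lam : Λ, ⇑(b lam) =ᵐ[μ] expChar (lam : Fin 2 → ℝ)

/-- The standing assumption on the digit set: `a = (a₁,a₂)` has entries in `[1,p-1]`
and `Z(m_D) = ⋃_{j=1}^{p-1} (j·a/p + ℤ²)`. -/
def ZeroSetCond (p : ℕ) (D : Fin p → (Fin 2 → ℤ)) (a : Fin 2 → ℤ) : Prop :=
  (∀ i, 1 ≤ a i ∧ a i ≤ (p : ℤ) - 1) ∧
  ∀ ξ : Fin 2 → ℝ, mask (digitR D) ξ = 0 ↔
    ∃ j : ℕ, 1 ≤ j ∧ j ≤ p - 1 ∧ ∃ k : Fin 2 → ℤ,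
      ∀ i, ξ i = (j : ℝ) * (a i : ℝ) / p + (k i : ℝ)

/-- The upper-triangular expanding matrix `M = [[ρ₁⁻¹, c],[0, ρ₂⁻¹]]`. -/
def Mupper (ρ₁ ρ₂ c : ℝ) : Matrix (Fin 2) (Fin 2) ℝ := !![ρ₁⁻¹, c; 0, ρ₂⁻¹]

/-- The set `E_a = {h/l : gcd(h,l)=1, l·a₂ − h·a₁ ∈ ℤ∖pℤ} ∪ {0}`. -/
def Ea (p : ℕ) (a : Fin 2 → ℤ) : Set ℝ :=
  {x | ∃ h l : ℤ, Int.gcd h l = 1 ∧ ¬ ((p : ℤ) ∣ (l * a 1 - h * a 0)) ∧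
    x = (h : ℝ) / (l : ℝ)} ∪ {0}



lemma nt_exists_val (p : ℕ) (hp : p.Prime) :
    ∃ V : ValuationSubring ℝ, V.valuation (p : ℝ) < 1 ∧
      ∀ m : ℤ, ¬ (p : ℤ) ∣ m → V.valuation (m : ℝ) = 1 := by
  let A : Subring ℝ := (Int.castRingHom ℝ).range
  let P : A := ⟨(p : ℝ), ⟨(p : ℤ), by simp⟩⟩
  have hI : Ideal.span {P} ≠ ⊤ := by
    rw [Ne, Ideal.span_singleton_eq_top]
    intro hu
    obtain ⟨⟨w, ⟨n, hn⟩⟩, hw⟩ := isUnit_iff_exists_inv.mp hu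
    have h1 : (p : ℝ) * (n : ℝ) = 1 := by
      have := congrArg Subtype.val hw
      simpa [P, ← hn] using this
    have h2 : (p : ℤ) * n = 1 := by exact_mod_cast h1
    have h3 : (p : ℤ) ∣ 1 := ⟨n, h2.symm⟩
    have h4 : p ∣ 1 := by exact_mod_cast h3
    exact hp.one_lt.ne' (Nat.dvd_one.mp h4)
  obtain ⟨V, hV1, hV2⟩ := Ideal.image_subset_nonunits_valuationSubring _ hI
  have hp1 : V.valuation (p : ℝ) < 1 := by
    have : (p : ℝ) ∈ V.nonunits := hV2 ⟨P, Ideal.mem_span_singleton_self P, rfl⟩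
    exact this
  refine ⟨V, hp1, ?_⟩
  intro m hm
  have hint : ∀ n : ℤ, V.valuation (n : ℝ) ≤ 1 := fun n =>
    (V.valuation_le_one_iff _).2 (intCast_mem V n)
  have hcop : IsCoprime (p : ℤ) m := by
    rw [Prime.coprime_iff_not_dvd (Nat.prime_iff_prime_int.mp hp)]; exact hm
  obtain ⟨u, w, huw⟩ := hcop
  refine le_antisymm (hint m) ?_
  by_contra hlt
  push Not at hlt
  have hr : (u : ℝ) * p + w * m = 1 := by exact_mod_cast huw
  have h1 : V.valuation ((u : ℝ) * p + w * m) < 1 := by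
    apply Valuation.map_add_lt
    · rw [map_mul]; exact (mul_le_of_le_one_left' (hint u)).trans_lt hp1
    · rw [map_mul]; exact (mul_le_of_le_one_left' (hint w)).trans_lt hlt
  rw [hr, map_one] at h1
  exact lt_irrefl _ h1

/-- The valuation of the base cannot be one. -/
lemma nt_val_ne_one {ι : Type*} (p : ℕ) (hp : p.Prime) (b : ℝ)
    (x : ι → ℝ) (κ : ι → ι → ℕ) (m : ι → ι → ℤ)
    (h1 : ∀ s t, s ≠ t → x s - x t = b ^ κ s t * m s t ∧ ¬ (p : ℤ) ∣ m s t ∧ 1 ≤ κ s t)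
    (h2 : ∀ k, 1 ≤ k → ∃ s t, s ≠ t ∧ κ s t = k)
    (V : ValuationSubring ℝ) (hV0 : V.valuation (p : ℝ) < 1)
    (hV : ∀ m : ℤ, ¬ (p : ℤ) ∣ m → V.valuation (m : ℝ) = 1) :
    V.valuation b ≠ 1 := by
  intro hb
  have : Fact p.Prime := ⟨hp⟩
  let K := IsLocalRing.ResidueField V
  let res : V →+* K := IsLocalRing.residue V
  have hbV : b ∈ V := (V.valuation_le_one_iff _).1 hb.le
  let B : V := ⟨b, hbV⟩
  have hpK : ((p : ℕ) : K) = 0 := by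
    have : res (p : V) = 0 := by
      rw [IsLocalRing.residue_eq_zero_iff, V.valuation_lt_one_iff]
      simpa using hV0
    simpa using this
  have : CharP K p := by
    have h0 : ringChar K ∣ p := (ringChar.spec K p).1 hpK
    rcases (Nat.dvd_prime hp).1 h0 with h | h
    · exact absurd h (CharP.ringChar_ne_one)
    · exact ringChar.of_eq h
  let : Algebra (ZMod p) K := ZMod.algebra K p
  have hmK : ∀ n : ℤ, ¬ (p : ℤ) ∣ n → ((n : ℤ) : ZMod p) ≠ 0 := by
    intro n hn h0
    exact hn ((ZMod.intCast_zmod_eq_zero_iff_dvd n p).1 h0)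
  have hmK' : ∀ n : ℤ, ¬ (p : ℤ) ∣ n → ((n : ℤ) : K) ≠ 0 := by
    intro n hn h0
    exact hn ((CharP.intCast_eq_zero_iff K p n).1 h0)
  have hB : res B ≠ 0 := by
    intro h0
    rw [IsLocalRing.residue_eq_zero_iff, V.valuation_lt_one_iff] at h0
    exact absurd hb h0.ne
  obtain ⟨s0, t0, hst0, hk0⟩ := h2 1 le_rfl
  -- elements of V
  have hxV : ∀ t, x t - x s0 ∈ V := by
    intro t
    by_cases h : t = s0
    · subst h; simp
    · rw [(h1 t s0 h).1]
      exact V.mul_mem _ _ (V.toSubring.pow_mem hbV _) (intCast_mem V _)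
  let y : ι → K := fun t => res ⟨x t - x s0, hxV t⟩
  have hy : ∀ s t, s ≠ t → y s - y t = (res B) ^ κ s t * (m s t : K) := by
    intro s t hst
    have : (⟨x s - x s0, hxV s⟩ : V) - ⟨x t - x s0, hxV t⟩ = B ^ κ s t * (m s t : V) := by
      apply Subtype.ext
      have := (h1 s t hst).1
      push_cast
      show x s - x s0 - (x t - x s0) = b ^ κ s t * (m s t : ℝ)
      linarith
    simp only [y]
    rw [← map_sub, this]
    simp
  have hyinj : Function.Injective y := by
    intro s t hst
    by_contra hne
    have := hy s t hne
    rw [hst, sub_self] at this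
    exact mul_ne_zero (pow_ne_zero _ hB) (hmK' _ (h1 s t hne).2.1) this.symm
  have hinf : ¬ Finite ι := by
    intro hfin
    have : Set.Finite (Set.range (fun q : ι × ι => κ q.1 q.2)) := Set.finite_range _
    obtain ⟨N, hN⟩ := this.bddAbove
    obtain ⟨s, t, -, hk⟩ := h2 (N + 1) (by omega)
    have := hN ⟨(s, t), rfl⟩
    simp only at this
    omega
  by_cases halg : IsAlgebraic (ZMod p) (res B)
  · have hint : IsIntegral (ZMod p) (res B) := halg.isIntegral
    have hfin : Module.Finite (ZMod p) (Algebra.adjoin (ZMod p) {res B}) :=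
      Algebra.finite_adjoin_simple_of_isIntegral hint
    have : Finite (Algebra.adjoin (ZMod p) {res B}) := Module.finite_of_finite (ZMod p)
    apply hinf
    have hmem : ∀ t, y t ∈ Algebra.adjoin (ZMod p) {res B} := by
      intro t
      by_cases h : t = s0
      · have : y t = 0 := by
          have h0 : (⟨x t - x s0, hxV t⟩ : V) = 0 := by
            apply Subtype.ext; subst h; simp
          simp only [y]; rw [h0, map_zero]
        rw [this]; exact zero_mem _
      · have h0 : y s0 = 0 := by
          have h0 : (⟨x s0 - x s0, hxV s0⟩ : V) = 0 := by
            apply Subtype.ext; simp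
          simp only [y]; rw [h0, map_zero]
        have := hy t s0 h
        rw [h0, sub_zero] at this
        rw [this]
        exact mul_mem (pow_mem (Algebra.self_mem_adjoin_singleton _ _) _) (intCast_mem _ _)
    exact Finite.of_injective (fun t => (⟨y t, hmem t⟩ : Algebra.adjoin (ZMod p) {res B}))
      (fun s t hst => hyinj (congrArg Subtype.val hst))
  · -- transcendental: all levels are equal
    have key : ∀ (k1 k2 k3 : ℕ) (m1 m2 m3 : ℤ), ¬ (p : ℤ) ∣ m1 → ¬ (p : ℤ) ∣ m2 → ¬ (p : ℤ) ∣ m3 →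
        (res B) ^ k1 * (m1 : K) + (res B) ^ k2 * (m2 : K) + (res B) ^ k3 * (m3 : K) = 0 →
        k1 = k2 ∧ k1 = k3 := by
      intro k1 k2 k3 m1 m2 m3 hm1 hm2 hm3 heq
      by_contra hne
      apply halg
      refine ⟨Polynomial.monomial k1 (m1 : ZMod p) + Polynomial.monomial k2 (m2 : ZMod p)
        + Polynomial.monomial k3 (m3 : ZMod p), ?_, ?_⟩
      · intro h0
        have hc : ∀ j, (if k1 = j then (m1 : ZMod p) else 0) + (if k2 = j then (m2 : ZMod p) else 0)
          + (if k3 = j then (m3 : ZMod p) else 0) = 0 := by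
          intro j
          have := congrArg (fun q => Polynomial.coeff q j) h0
          simpa [Polynomial.coeff_monomial] using this
        have e1 := hc k1
        have e2 := hc k2
        have e3 := hc k3
        have n1 := hmK _ hm1
        have n2 := hmK _ hm2
        have n3 := hmK _ hm3
        by_cases h12 : k1 = k2
        · by_cases h13 : k1 = k3
          · exact hne ⟨h12, h13⟩
          · have h23 : ¬ k2 = k3 := by omega
            simp [h13, h23] at e3
            exact n3 e3
        · by_cases h13 : k1 = k3
          · have h32 : ¬ k3 = k2 := by omega
            simp [h12, h32] at e2
            exact n2 e2
          · have h21 : ¬ k2 = k1 := by omega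
            have h31 : ¬ k3 = k1 := by omega
            simp [h21, h31] at e1
            exact n1 e1
      · simp only [map_add, Polynomial.aeval_monomial, map_intCast]
        rw [← heq]; ring
    have hsymm : ∀ s t, s ≠ t → ∀ u, u ≠ s → κ s t = κ s u := by
      intro s t hst u hus
      by_cases htu : t = u
      · rw [htu]
      have e1 := hy s t hst
      have e2 := hy s u (Ne.symm hus)
      have e3 := hy t u htu
      have hn : ¬ (p : ℤ) ∣ -m s u := by
        rw [dvd_neg]; exact (h1 s u (Ne.symm hus)).2.1
      refine (key (κ s t) (κ t u) (κ s u) (m s t) (m t u) (-m s u) (h1 s t hst).2.1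
        (h1 t u htu).2.1 hn ?_).2
      push_cast
      rw [← e1, ← e3, mul_neg, ← e2]; ring
    have hsw : ∀ s t, s ≠ t → κ s t = κ t s := by
      intro s t hst
      have e1 := hy s t hst
      have e2 := hy t s (Ne.symm hst)
      obtain ⟨u, hu⟩ : ∃ u, u ≠ s ∧ u ≠ t := by
        by_contra hcon
        push Not at hcon
        apply hinf
        apply Finite.of_surjective (fun c : Bool => if c then s else t)
        intro u
        by_cases hus : u = s
        · exact ⟨true, by simp [hus]⟩
        · exact ⟨false, by simp [hcon u hus]⟩
      have a1 := hsymm s t hst u hu.1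
      have a2 := hsymm t s (Ne.symm hst) u hu.2
      have e3 := hy s u (Ne.symm hu.1)
      have e4 := hy t u (Ne.symm hu.2)
      have hn : ¬ (p : ℤ) ∣ -m s u := by
        rw [dvd_neg]; exact (h1 s u (Ne.symm hu.1)).2.1
      have := (key (κ s t) (κ t u) (κ s u) (m s t) (m t u) (-m s u) (h1 s t hst).2.1
        (h1 t u (Ne.symm hu.2)).2.1 hn (by
          push_cast
          rw [← e1, ← e4, mul_neg, ← e3]; ring)).1
      omega
    obtain ⟨s, t, hst, hk1⟩ := h2 1 le_rfl
    obtain ⟨u, w, huw, hk2⟩ := h2 2 (by norm_num)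
    by_cases hsu : s = u
    · subst hsu
      have := hsymm s t hst w (Ne.symm huw)
      omega
    · have a1 := hsymm s t hst u (Ne.symm hsu)
      have a2 := hsymm u w huw s hsu
      have a3 := hsw s u hsu
      omega

lemma nt_pow_inj {Γ : Type*} [LinearOrderedCommGroupWithZero Γ] {β : Γ} (h0 : β ≠ 0) (h1 : β ≠ 1)
    {i j : ℕ} (h : β ^ i = β ^ j) : i = j := by
  have h0' : 0 < β := zero_lt_iff.2 h0
  rcases lt_or_gt_of_ne h1 with hb | hb
  · exact (pow_right_strictAnti₀ h0' hb).injective h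
  · exact (pow_right_strictMono₀ hb).injective h

lemma nt_main {ι : Type*} (p : ℕ) (hp : p.Prime) (b : ℝ) (hb : 1 < b)
    (x : ι → ℝ) (κ : ι → ι → ℕ) (m : ι → ι → ℤ)
    (h1 : ∀ s t, s ≠ t → x s - x t = b ^ κ s t * m s t ∧ ¬ (p : ℤ) ∣ m s t ∧ 1 ≤ κ s t)
    (h2 : ∀ k, 1 ≤ k → ∃ s t, s ≠ t ∧ κ s t = k) :
    ∃ r q : ℕ, 1 ≤ q ∧ q < r ∧ p ∣ r ∧ Nat.Coprime r q ∧ b = (r : ℝ) / q ∧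
      ∀ s t, s ≠ t → (q : ℤ) ^ (κ s t - 1) ∣ m s t := by
  obtain ⟨V, hV0, hV⟩ := nt_exists_val p hp
  have hβ1 := nt_val_ne_one p hp b x κ m h1 h2 V hV0 hV
  set v := V.valuation with hv
  have hb0 : b ≠ 0 := by positivity
  have hβ0 : v b ≠ 0 := (Valuation.ne_zero_iff v).2 hb0
  have hval : ∀ s t, s ≠ t → v (x s - x t) = v b ^ κ s t := by
    intro s t hst
    rw [(h1 s t hst).1, map_mul, map_pow, hV _ (h1 s t hst).2.1, mul_one]
  have hsymm : ∀ s t, s ≠ t → κ s t = κ t s := by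
    intro s t hst
    apply nt_pow_inj hβ0 hβ1
    rw [← hval s t hst, ← hval t s hst.symm, Valuation.map_sub_swap]
  have hm0 : ∀ s t, s ≠ t → (m s t : ℝ) ≠ 0 := by
    intro s t hst h0
    apply (h1 s t hst).2.1
    have : m s t = 0 := by exact_mod_cast h0
    rw [this]; exact dvd_zero _
  have hdec : ∀ s t u, x s - x u = (x s - x t) + (x t - x u) := fun s t u => by ring
  have hbpos : ∀ k : ℕ, b ^ k ≠ 0 := fun k => pow_ne_zero _ hb0
  -- rationality
  have hR : ∀ s t u, s ≠ t → s ≠ u → ∃ ρ : ℚ, b ^ κ s t = (ρ : ℝ) * b ^ κ s u := by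
    intro s t u hst hsu
    by_cases htu : t = u
    · exact ⟨1, by rw [htu]; simp⟩
    have e1 := (h1 s t hst).1
    have e2 := (h1 t u htu).1
    have e3 := (h1 s u hsu).1
    have e := hdec s t u
    by_cases k13 : κ s t = κ s u
    · exact ⟨1, by rw [k13]; simp⟩
    by_cases k12 : κ s t = κ t u
    · have hne : (m s t : ℝ) + m t u ≠ 0 := by
        intro h0
        have : b ^ κ s u * (m s u : ℝ) = 0 := by
          rw [← e3, e, e1, e2, ← k12, ← mul_add, h0, mul_zero]
        exact mul_ne_zero (hbpos _) (hm0 s u hsu) this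
      refine ⟨(m s u : ℚ) / ((m s t : ℚ) + m t u), ?_⟩
      push_cast
      rw [div_mul_eq_mul_div, eq_div_iff hne, mul_add]
      nth_rewrite 2 [k12]
      rw [← e1, ← e2, ← e, e3, mul_comm]
    by_cases k23 : κ t u = κ s u
    · refine ⟨((m s u : ℚ) - m t u) / (m s t : ℚ), ?_⟩
      push_cast
      rw [div_mul_eq_mul_div, eq_div_iff (hm0 s t hst), sub_mul, mul_comm _ (b ^ κ s u), ← e3]
      rw [← k23, mul_comm _ (b ^ κ t u), ← e2, ← e1]; ring
    exfalso
    have v1 := hval s t hst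
    have v2 := hval t u htu
    have v3 := hval s u hsu
    rw [e] at v3
    rcases lt_trichotomy (v (x s - x t)) (v (x t - x u)) with h | h | h
    · rw [Valuation.map_add_eq_of_lt_right v h, v2] at v3
      exact k23 (nt_pow_inj hβ0 hβ1 v3)
    · rw [v1, v2] at h
      exact k12 (nt_pow_inj hβ0 hβ1 h)
    · rw [Valuation.map_add_eq_of_lt_left v h, v1] at v3
      exact k13 (nt_pow_inj hβ0 hβ1 v3)
  have hrat : ∃ ρ : ℚ, b = ρ := by
    obtain ⟨s, t, hst, hk1⟩ := h2 1 le_rfl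
    obtain ⟨u, w, huw, hk2⟩ := h2 2 (by norm_num)
    have : ∃ ρ : ℚ, b ^ 2 = (ρ : ℝ) * b ^ 1 := by
      by_cases hsu : s = u
      · subst hsu
        obtain ⟨ρ, hρ⟩ := hR s w t huw hst
        exact ⟨ρ, by rw [hk1, hk2] at hρ; exact hρ⟩
      · obtain ⟨ρ, hρ⟩ := hR u w s huw (Ne.symm hsu)
        obtain ⟨ρ', hρ'⟩ := hR s u t hsu hst
        rw [hsymm s u hsu, hk1] at hρ'
        rw [hk2, hρ'] at hρ
        exact ⟨ρ * ρ', by push_cast; rw [hρ]; ring⟩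
    obtain ⟨ρ, hρ⟩ := this
    refine ⟨ρ, ?_⟩
    have : b * b = ρ * b := by rw [← sq, hρ, pow_one]
    exact mul_right_cancel₀ hb0 this
  obtain ⟨ρ, hρ⟩ := hrat
  have hρpos : 0 < ρ := by
    have : (0 : ℝ) < ρ := by rw [← hρ]; linarith
    exact_mod_cast this
  obtain ⟨r, hr⟩ : ∃ r : ℕ, ρ.num = r := ⟨ρ.num.toNat, (Int.toNat_of_nonneg (Rat.num_nonneg.2 hρpos.le)).symm⟩
  obtain ⟨q, hq⟩ : ∃ q : ℕ, ρ.den = q := ⟨_, rfl⟩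
  have hq1 : 1 ≤ q := by rw [← hq]; exact ρ.den_pos
  have hcop : Nat.Coprime r q := by
    have := ρ.reduced
    rw [hr, hq] at this
    simpa using this
  have hbq : b = (r : ℝ) / q := by
    rw [hρ, Rat.cast_def, hr, hq]; simp
  have hqR : (q : ℝ) ≠ 0 := by positivity
  have hqr : q < r := by
    rw [hbq, lt_div_iff₀ (by positivity), one_mul] at hb
    exact_mod_cast hb
  have hr0 : (r : ℝ) ≠ 0 := by
    have : 0 < r := by omega
    positivity
  have hb_r : v b * v (q : ℝ) = v (r : ℝ) := by
    rw [← map_mul, hbq, div_mul_cancel₀ _ hqR]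
  have hcopI : IsCoprime (r : ℤ) (q : ℤ) := Nat.isCoprime_iff_coprime.2 hcop
  -- clearing denominators
  have hclear : ∀ (k n : ℕ) (A B : ℤ), b ^ (k + n) * (A : ℝ) = b ^ k * B →
      (r : ℤ) ^ n * A = (q : ℤ) ^ n * B := by
    intro k n A B h
    have h' : b ^ n * (A : ℝ) = B := by
      rw [pow_add, mul_assoc] at h
      exact mul_left_cancel₀ (hbpos k) h
    rw [hbq, div_pow, div_mul_eq_mul_div, div_eq_iff (pow_ne_zero _ hqR)] at h'
    have : (r : ℝ) ^ n * A = (q : ℝ) ^ n * B := by rw [h']; ring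
    exact_mod_cast this
  by_cases hpr : p ∣ r
  · refine ⟨r, q, hq1, hqr, hpr, hcop, hbq, ?_⟩
    have hpq : ¬ (p : ℤ) ∣ (q : ℤ) := by
      intro h
      have h' : p ∣ q := by exact_mod_cast h
      have := Nat.dvd_gcd hpr h'
      rw [hcop] at this
      exact hp.one_lt.ne' (Nat.dvd_one.mp this)
    have hvq : v (q : ℝ) = 1 := by simpa using hV q hpq
    rw [hvq, mul_one] at hb_r
    have hint : ∀ n : ℤ, v (n : ℝ) ≤ 1 := fun n =>
      (V.valuation_le_one_iff _).2 (intCast_mem V n)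
    have hβlt : v b < 1 := by
      obtain ⟨n, hn⟩ := hpr
      rw [hb_r, hn]
      push_cast
      rw [map_mul]
      have : v (n : ℝ) ≤ 1 := by simpa using hint n
      exact (mul_le_of_le_one_right' this).trans_lt hV0
    have hβpos : 0 < v b := zero_lt_iff.2 hβ0
    intro s t hst
    by_cases hk : κ s t = 1
    · rw [hk]; simp
    have hk2 : 1 < κ s t := by have := (h1 s t hst).2.2; omega
    obtain ⟨c, d, hcd, hkcd⟩ := h2 1 le_rfl
    have hle : ∀ s t, s ≠ t → v (x s - x t) ≤ v b := by
      intro s t hst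
      rw [hval s t hst]
      calc v b ^ κ s t ≤ v b ^ 1 := (pow_right_strictAnti₀ hβpos hβlt).antitone (h1 s t hst).2.2
        _ = v b := pow_one _
    have hex : ∃ e, s ≠ e ∧ κ s e = 1 := by
      by_cases hsc : s = c
      · exact ⟨d, hsc ▸ hcd, by rw [hsc, hkcd]⟩
      by_cases hsd : s = d
      · exact ⟨c, hsc, by rw [hsymm s c hsc, hsd, hkcd]⟩
      by_contra hcon
      push Not at hcon
      have n1 := hcon c hsc
      have n2 := hcon d hsd
      have lt1 : ∀ e, s ≠ e → κ s e ≠ 1 → v (x s - x e) < v b := by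
        intro e hse hne
        refine lt_of_le_of_ne (hle s e hse) ?_
        intro h
        rw [hval s e hse] at h
        exact hne (nt_pow_inj hβ0 hβ1 (by rw [h, pow_one]))
      have : v (x c - x d) < v b := by
        have e : x c - x d = (x s - x d) - (x s - x c) := by ring
        rw [e]
        exact Valuation.map_sub_lt v (lt1 d hsd n2) (lt1 c hsc n1)
      rw [hval c d hcd, hkcd, pow_one] at this
      exact lt_irrefl _ this
    obtain ⟨e, hse, hke⟩ := hex
    have het : e ≠ t := by
      rintro rfl; omega
    have hket : κ e t = 1 := by
      apply nt_pow_inj hβ0 hβ1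
      rw [← hval e t het, hdec e s t, pow_one]
      have v1 : v (x e - x s) = v b := by
        rw [hval e s hse.symm, ← hsymm s e hse, hke, pow_one]
      rw [Valuation.map_add_eq_of_lt_left, v1]
      rw [v1, hval s t hst]
      calc v b ^ κ s t < v b ^ 1 := pow_lt_pow_right_of_lt_one₀ hβpos hβlt hk2
        _ = v b := pow_one _
    have E : b ^ (1 + (κ s t - 1)) * (m s t : ℝ) = b ^ 1 * ((m s e + m e t : ℤ) : ℝ) := by
      have : 1 + (κ s t - 1) = κ s t := by omega
      rw [this, ← (h1 s t hst).1, hdec s e t, (h1 s e hse).1, (h1 e t het).1, hke, hket]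
      push_cast; ring
    have := hclear _ _ _ _ E
    have hd : (q : ℤ) ^ (κ s t - 1) ∣ (r : ℤ) ^ (κ s t - 1) * m s t := ⟨_, this⟩
    exact (IsCoprime.pow hcopI.symm).dvd_of_dvd_mul_left hd
  · exfalso
    have hvr : v (r : ℝ) = 1 := by
      have : ¬ (p : ℤ) ∣ (r : ℤ) := by exact_mod_cast hpr
      simpa using hV r this
    rw [hvr] at hb_r
    have hβgt : 1 < v b := by
      refine lt_of_le_of_ne ?_ hβ1.symm
      by_contra hlt
      push Not at hlt
      have hq' : v (q : ℝ) ≤ 1 := by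
        exact (V.valuation_le_one_iff _).2 (natCast_mem V q)
      have : v b * v (q : ℝ) < 1 := (mul_le_of_le_one_right' hq').trans_lt hlt
      rw [hb_r] at this
      exact lt_irrefl _ this
    obtain ⟨s, t, hst, hk1⟩ := h2 1 le_rfl
    obtain ⟨u, w, huw, hkuw⟩ := h2 (2 + (m s t).natAbs) (by omega)
    have hmono : ∀ i j : ℕ, v b ^ i < v b ^ j ↔ i < j := fun i j =>
      (pow_right_strictMono₀ hβgt).lt_iff_lt
    have hex : ∃ e, s ≠ e ∧ 2 + (m s t).natAbs ≤ κ s e := by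
      by_cases hsu : s = u
      · exact ⟨w, hsu ▸ huw, by rw [← hkuw, hsu]⟩
      by_cases hsw : s = w
      · exact ⟨u, hsu, by rw [hsymm s u hsu, ← hkuw, hsw]⟩
      by_contra hcon
      push Not at hcon
      have n1 := hcon u hsu
      have n2 := hcon w hsw
      have : v (x u - x w) < v b ^ (2 + (m s t).natAbs) := by
        have e : x u - x w = (x s - x w) - (x s - x u) := by ring
        rw [e]
        refine Valuation.map_sub_lt v ?_ ?_
        · rw [hval s w hsw]; exact (hmono _ _).2 n2
        · rw [hval s u hsu]; exact (hmono _ _).2 n1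
      rw [hval u w huw, hkuw] at this
      exact lt_irrefl _ this
    obtain ⟨e, hse, hke⟩ := hex
    have hte : t ≠ e := by
      rintro rfl; omega
    have hkte : κ t e = κ s e := by
      apply nt_pow_inj hβ0 hβ1
      rw [← hval t e hte, hdec t s e, ← hval s e hse]
      apply Valuation.map_add_eq_of_lt_right
      rw [hval t s hst.symm, ← hsymm s t hst, hk1, hval s e hse]
      exact (hmono _ _).2 (by omega)
    have E : b ^ (1 + (κ s e - 1)) * ((m s e - m t e : ℤ) : ℝ) = b ^ 1 * (m s t : ℝ) := by
      have : 1 + (κ s e - 1) = κ s e := by omega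
      rw [this]
      push_cast
      rw [mul_sub, ← (h1 s e hse).1, ← hkte, ← (h1 t e hte).1, ← hk1, ← (h1 s t hst).1]
      ring
    have := hclear _ _ _ _ E
    have hd : (r : ℤ) ^ (κ s e - 1) ∣ (q : ℤ) ^ (κ s e - 1) * m s t := ⟨_, this.symm⟩
    have hd' := (IsCoprime.pow (m := κ s e - 1) (n := κ s e - 1) hcopI).dvd_of_dvd_mul_left hd
    have hne : m s t ≠ 0 := by
      intro h0; exact hm0 s t hst (by rw [h0]; simp)
    have hle := Int.natAbs_le_of_dvd_ne_zero hd' hne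
    rw [Int.natAbs_pow, Int.natAbs_natCast] at hle
    have h3 : κ s e - 1 < r ^ (κ s e - 1) := Nat.lt_pow_self (by omega)
    omega

/-- Coordinatewise scaling by `b ^ (-k)`. -/
def sc (b : Fin 2 → ℝ) (k : ℕ) (ξ : Fin 2 → ℝ) : Fin 2 → ℝ := fun i => ξ i / b i ^ k

lemma sc_add (b : Fin 2 → ℝ) (k : ℕ) (ξ η : Fin 2 → ℝ) : sc b k (ξ + η) = sc b k ξ + sc b k η := by
  funext i; simp [sc, add_div]

lemma sc_sub (b : Fin 2 → ℝ) (k : ℕ) (ξ η : Fin 2 → ℝ) : sc b k (ξ - η) = sc b k ξ - sc b k η := by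
  funext i; simp [sc, sub_div]

lemma sc_sc (b : Fin 2 → ℝ) (k l : ℕ) (ξ : Fin 2 → ℝ) : sc b l (sc b k ξ) = sc b (k + l) ξ := by
  funext i; simp [sc, pow_add, div_div]

lemma expChar_norm (ξ x : Fin 2 → ℝ) : ‖expChar ξ x‖ = 1 := by
  unfold expChar
  rw [show (-2 * Real.pi * Complex.I) * ((ξ 0 * x 0 + ξ 1 * x 1 : ℝ) : ℂ)
    = ((-2 * Real.pi * (ξ 0 * x 0 + ξ 1 * x 1) : ℝ) : ℂ) * Complex.I by push_cast; ring]
  exact Complex.norm_exp_ofReal_mul_I _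

lemma expChar_add_left (ξ η x : Fin 2 → ℝ) : expChar (ξ + η) x = expChar ξ x * expChar η x := by
  unfold expChar
  rw [← Complex.exp_add]
  congr 1; simp only [Pi.add_apply]; push_cast; ring

lemma expChar_add_right (ξ x y : Fin 2 → ℝ) : expChar ξ (x + y) = expChar ξ x * expChar ξ y := by
  unfold expChar
  rw [← Complex.exp_add]
  congr 1; simp only [Pi.add_apply]; push_cast; ring

lemma expChar_zero_left (x : Fin 2 → ℝ) : expChar 0 x = 1 := by
  simp [expChar]

lemma expChar_zero_right (x : Fin 2 → ℝ) : expChar x 0 = 1 := by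
  simp [expChar]

lemma expChar_conj (ξ x : Fin 2 → ℝ) : (starRingEnd ℂ) (expChar ξ x) = expChar (-ξ) x := by
  unfold expChar
  rw [← Complex.exp_conj]
  congr 1
  simp only [map_mul, map_neg, Complex.conj_I, Complex.conj_ofReal, Pi.neg_apply, map_ofNat]
  push_cast; ring

lemma expChar_continuous : Continuous (fun z : (Fin 2 → ℝ) × (Fin 2 → ℝ) => expChar z.1 z.2) := by
  unfold expChar
  fun_prop

lemma expChar_continuous_right (ξ : Fin 2 → ℝ) : Continuous (expChar ξ) :=
  expChar_continuous.comp (Continuous.prodMk continuous_const continuous_id)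

lemma expChar_continuous_left (x : Fin 2 → ℝ) : Continuous (fun ξ => expChar ξ x) :=
  expChar_continuous.comp (Continuous.prodMk continuous_id continuous_const)

lemma expChar_integrable (μ : Measure (Fin 2 → ℝ)) [IsProbabilityMeasure μ] (ξ : Fin 2 → ℝ) :
    Integrable (expChar ξ) μ := by
  refine Integrable.of_bound (C := 1) (expChar_continuous_right ξ).aestronglyMeasurable ?_
  filter_upwards with x
  rw [expChar_norm]

lemma ft_norm_le (μ : Measure (Fin 2 → ℝ)) [IsProbabilityMeasure μ] (ξ : Fin 2 → ℝ) :
    ‖ftMeasure μ ξ‖ ≤ 1 := by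
  unfold ftMeasure
  refine (norm_integral_le_integral_norm _).trans ?_
  simp [expChar_norm]

lemma ft_zero (μ : Measure (Fin 2 → ℝ)) [IsProbabilityMeasure μ] : ftMeasure μ 0 = 1 := by
  simp [ftMeasure, expChar_zero_left]

lemma ft_continuous (μ : Measure (Fin 2 → ℝ)) [IsProbabilityMeasure μ] :
    Continuous (ftMeasure μ) := by
  unfold ftMeasure
  refine continuous_of_dominated (bound := fun _ => 1) ?_ ?_ (integrable_const _) ?_
  · intro ξ; exact (expChar_continuous_right ξ).aestronglyMeasurable
  · intro ξ; filter_upwards with x; rw [expChar_norm]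
  · filter_upwards with x; exact expChar_continuous_left x

lemma mask_norm_le {p : ℕ} (D : Fin p → (Fin 2 → ℝ)) (ξ : Fin 2 → ℝ) : ‖mask D ξ‖ ≤ 1 := by
  unfold mask
  rw [norm_mul, norm_inv, Complex.norm_natCast]
  have h : ‖∑ i : Fin p, expChar ξ (D i)‖ ≤ p := by
    refine (norm_sum_le _ _).trans ?_
    simp [expChar_norm]
  rcases Nat.eq_zero_or_pos p with h0 | h0
  · subst h0; simp
  · rw [inv_mul_le_iff₀ (by positivity)]; simpa using h

lemma ft_selfaffine {p : ℕ} (μ : Measure (Fin 2 → ℝ)) (b : Fin 2 → ℝ) (hb : ∀ i, b i ≠ 0)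
    (D : Fin p → (Fin 2 → ℝ)) (hμ : IsSelfAffine μ !![b 0, 0; 0, b 1] D) (ξ : Fin 2 → ℝ) :
    ftMeasure μ ξ = mask D (sc b 1 ξ) * ftMeasure μ (sc b 1 ξ) := by
  obtain ⟨hprob, -, hself⟩ := hμ
  have hinv : (!![b 0, 0; 0, b 1] : Matrix (Fin 2) (Fin 2) ℝ)⁻¹ = !![(b 0)⁻¹, 0; 0, (b 1)⁻¹] := by
    apply Matrix.inv_eq_right_inv
    ext i j
    fin_cases i <;> fin_cases j <;> simp [Matrix.mul_apply, Fin.sum_univ_two, hb]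
  have hmap : ∀ (d x : Fin 2 → ℝ), (!![b 0, 0; 0, b 1] : Matrix (Fin 2) (Fin 2) ℝ)⁻¹.mulVec (x + d)
      = ![(x 0 + d 0) / b 0, (x 1 + d 1) / b 1] := by
    intro d x
    rw [hinv]
    ext i
    fin_cases i <;> simp [Matrix.mulVec, dotProduct, Fin.sum_univ_two, div_eq_inv_mul]
  have hcont : ∀ d : Fin 2 → ℝ, Continuous
      (fun x => (!![b 0, 0; 0, b 1] : Matrix (Fin 2) (Fin 2) ℝ)⁻¹.mulVec (x + d)) := by
    intro d; fun_prop
  have hmeas : ∀ d : Fin 2 → ℝ, Measurable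
      (fun x => (!![b 0, 0; 0, b 1] : Matrix (Fin 2) (Fin 2) ℝ)⁻¹.mulVec (x + d)) :=
    fun d => (hcont d).measurable
  have hpt : ∀ d x, expChar ξ ((!![b 0, 0; 0, b 1] : Matrix (Fin 2) (Fin 2) ℝ)⁻¹.mulVec (x + d))
      = expChar (sc b 1 ξ) d * expChar (sc b 1 ξ) x := by
    intro d x
    rw [hmap, ← expChar_add_right]
    unfold expChar
    congr 2
    simp [sc]
    ring
  have hi : ∀ i : Fin p, ∫ y, expChar ξ y ∂(μ.map
      (fun x => (!![b 0, 0; 0, b 1] : Matrix (Fin 2) (Fin 2) ℝ)⁻¹.mulVec (x + D i)))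
      = expChar (sc b 1 ξ) (D i) * ftMeasure μ (sc b 1 ξ) := by
    intro i
    rw [integral_map (hmeas _).aemeasurable (expChar_continuous_right ξ).aestronglyMeasurable]
    simp_rw [hpt]
    rw [integral_const_mul]; rfl
  have : ftMeasure μ ξ = ∫ x, expChar ξ x ∂((p : ℝ≥0∞)⁻¹ • ∑ i : Fin p, μ.map
      (fun x => (!![b 0, 0; 0, b 1] : Matrix (Fin 2) (Fin 2) ℝ)⁻¹.mulVec (x + D i))) := by
    rw [← hself]; rfl
  rw [this, integral_smul_measure, integral_finsetSum_measure]
  · simp_rw [hi]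
    rw [← Finset.sum_mul]
    simp only [mask, ENNReal.toReal_inv, ENNReal.toReal_natCast]
    rw [Complex.real_smul]
    push_cast
    ring
  · intro i _
    have := Measure.isProbabilityMeasure_map (μ := μ) (hmeas (D i)).aemeasurable
    exact expChar_integrable _ _

lemma ft_iter {p : ℕ} (μ : Measure (Fin 2 → ℝ)) (b : Fin 2 → ℝ) (hb : ∀ i, b i ≠ 0)
    (D : Fin p → (Fin 2 → ℝ)) (hμ : IsSelfAffine μ !![b 0, 0; 0, b 1] D) (ξ : Fin 2 → ℝ) (N : ℕ) :
    ftMeasure μ ξ = (∏ k ∈ Finset.Icc 1 N, mask D (sc b k ξ)) * ftMeasure μ (sc b N ξ) := by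
  induction N with
  | zero =>
    have : sc b 0 ξ = ξ := by funext i; simp [sc]
    simp [this]
  | succ n ih =>
    rw [ih, ft_selfaffine μ b hb D hμ (sc b n ξ), sc_sc, Finset.prod_Icc_succ_top (by omega)]
    ring

lemma sc_tendsto (b : Fin 2 → ℝ) (hb : ∀ i, 1 < b i) (ξ : Fin 2 → ℝ) :
    Filter.Tendsto (fun N => sc b N ξ) Filter.atTop (nhds 0) := by
  rw [tendsto_pi_nhds]
  intro i
  have h := (tendsto_pow_atTop_nhds_zero_of_lt_one (inv_nonneg.2 (by linarith [hb i] : 0 ≤ b i))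
    (inv_lt_one_of_one_lt₀ (hb i))).const_mul (ξ i)
  simp only [mul_zero, inv_pow] at h
  simpa [sc, div_eq_mul_inv] using h

lemma ft_eq_zero {p : ℕ} (μ : Measure (Fin 2 → ℝ)) (b : Fin 2 → ℝ) (hb : ∀ i, 1 < b i)
    (D : Fin p → (Fin 2 → ℝ)) (hμ : IsSelfAffine μ !![b 0, 0; 0, b 1] D) (ξ : Fin 2 → ℝ)
    (h : ftMeasure μ ξ = 0) : ∃ k, 1 ≤ k ∧ mask D (sc b k ξ) = 0 := by
  have hb0 : ∀ i, b i ≠ 0 := fun i => by have := hb i; positivity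
  have := hμ.1
  have ht : Filter.Tendsto (fun N => ftMeasure μ (sc b N ξ)) Filter.atTop (nhds 1) := by
    have := ((ft_continuous μ).tendsto 0).comp (sc_tendsto b hb ξ)
    rwa [ft_zero] at this
  obtain ⟨N, hN⟩ := (ht.eventually_ne one_ne_zero).exists
  rw [ft_iter μ b hb0 D hμ ξ N] at h
  rcases mul_eq_zero.1 h with h | h
  · obtain ⟨k, hk, hk0⟩ := Finset.prod_eq_zero_iff.1 h
    exact ⟨k, (Finset.mem_Icc.1 hk).1, hk0⟩
  · exact absurd h hN

lemma spectral_facts (μ : Measure (Fin 2 → ℝ)) [IsProbabilityMeasure μ] (h : IsSpectral μ) :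
    ∃ Λ : Set (Fin 2 → ℝ), Λ.Countable ∧
      (∀ s t : Λ, s ≠ t → ftMeasure μ ((s : Fin 2 → ℝ) - t) = 0) ∧
      ∀ ξ, HasSum (fun l : Λ => ‖ftMeasure μ (ξ + l)‖ ^ 2) 1 := by
  obtain ⟨Λ, hc, B, hB⟩ := h
  refine ⟨Λ, hc, ?_, ?_⟩
  · intro s t hst
    have h0 : inner ℂ (B t) (B s) = 0 := B.orthonormal.2 (Ne.symm hst)
    rw [L2.inner_def] at h0
    rw [← h0]
    unfold ftMeasure
    apply integral_congr_ae
    filter_upwards [hB s, hB t] with x hs ht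
    rw [hs, ht, RCLike.inner_apply, expChar_conj, ← expChar_add_left, sub_eq_add_neg]
  · intro ξ
    have hmem : MemLp (expChar (-ξ)) 2 μ :=
      MemLp.of_bound (expChar_continuous_right _).aestronglyMeasurable 1
        (by filter_upwards with x; rw [expChar_norm])
    let f : Lp ℂ 2 μ := hmem.toLp _
    have hf : ⇑f =ᵐ[μ] expChar (-ξ) := hmem.coeFn_toLp
    have hs := B.hasSum_inner_mul_inner f f
    have hff : inner ℂ f f = (1 : ℂ) := by
      rw [L2.inner_def]
      have : ∫ x, inner ℂ (f x) (f x) ∂μ = ∫ x, (1 : ℂ) ∂μ := by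
        apply integral_congr_ae
        filter_upwards [hf] with x hx
        rw [hx, RCLike.inner_apply, expChar_conj, ← expChar_add_left]
        simp [expChar_zero_left]
      rw [this]; simp
    have hfl : ∀ l : Λ, inner ℂ f (B l) = ftMeasure μ (ξ + l) := by
      intro l
      rw [L2.inner_def]
      unfold ftMeasure
      apply integral_congr_ae
      filter_upwards [hf, hB l] with x hx hl
      rw [hx, hl, RCLike.inner_apply, expChar_conj, ← expChar_add_left, neg_neg, add_comm]
    have hterm : ∀ l : Λ, inner ℂ f (B l) * inner ℂ (B l) f
        = ((‖ftMeasure μ (ξ + l)‖ ^ 2 : ℝ) : ℂ) := by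
      intro l
      rw [← hfl, ← inner_conj_symm (B l) f, RCLike.mul_conj]
      push_cast; rfl
    simp_rw [hterm, hff] at hs
    exact (RCLike.hasSum_ofReal ℂ).1 (by simpa using hs)


lemma mask_prod {n m : ℕ} (X : Fin n → (Fin 2 → ℝ)) (Y : Fin m → (Fin 2 → ℝ)) :
    ∃ Z : Fin (n * m) → (Fin 2 → ℝ), ∀ ξ, mask Z ξ = mask X ξ * mask Y ξ := by
  refine ⟨fun i => X (finProdFinEquiv.symm i).1 + Y (finProdFinEquiv.symm i).2, fun ξ => ?_⟩
  unfold mask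
  rw [Equiv.sum_comp finProdFinEquiv.symm
    (fun z : Fin n × Fin m => expChar ξ (X z.1 + Y z.2)), Fintype.sum_prod_type]
  simp_rw [expChar_add_right]
  rw [mul_mul_mul_comm, Finset.sum_mul_sum]
  push_cast
  rw [mul_inv]

lemma mask_sc {n : ℕ} (X : Fin n → (Fin 2 → ℝ)) (b : Fin 2 → ℝ) (k : ℕ) (ξ : Fin 2 → ℝ) :
    mask X (sc b k ξ) = mask (fun i => sc b k (X i)) ξ := by
  unfold mask expChar sc
  congr 1
  apply Finset.sum_congr rfl
  intro i _
  congr 3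
  ring

lemma mask_prod_rep {p : ℕ} (hp : 0 < p) (D : Fin p → (Fin 2 → ℝ)) (b : Fin 2 → ℝ)
    (S : Finset ℕ) : ∃ (n : ℕ) (X : Fin n → (Fin 2 → ℝ)), 0 < n ∧
      ∀ ξ, mask X ξ = ∏ k ∈ S, mask D (sc b k ξ) := by
  induction S using Finset.induction_on with
  | empty => exact ⟨1, fun _ => 0, one_pos, fun ξ => by simp [mask, expChar_zero_right]⟩
  | insert k S hk ih =>
    obtain ⟨n, X, hn, hX⟩ := ih
    obtain ⟨Z, hZ⟩ := mask_prod (fun i => sc b k (D i)) X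
    refine ⟨p * n, Z, Nat.mul_pos hp hn, fun ξ => ?_⟩
    rw [hZ, hX, Finset.prod_insert hk, mask_sc]

lemma mask_bessel {n : ℕ} (hn : 0 < n) (X : Fin n → (Fin 2 → ℝ)) (F : Finset (Fin 2 → ℝ))
    (h : ∀ s ∈ F, ∀ t ∈ F, s ≠ t → mask X (s - t) = 0) (ξ : Fin 2 → ℝ) :
    ∑ s ∈ F, ‖mask X (ξ + s)‖ ^ 2 ≤ 1 := by
  have hn' : (0 : ℝ) < n := by exact_mod_cast hn
  let v : (Fin 2 → ℝ) → EuclideanSpace ℂ (Fin n) :=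
    fun s => WithLp.toLp 2 (fun i => (((√(n : ℝ))⁻¹ : ℝ) : ℂ) * expChar (-s) (X i))
  have hin : ∀ s t, inner ℂ (v s) (v t) = mask X (s - t) := by
    intro s t
    simp only [v, PiLp.inner_apply, RCLike.inner_apply, map_mul, expChar_conj, Complex.conj_ofReal,
      neg_neg]
    unfold mask
    rw [Finset.mul_sum]
    apply Finset.sum_congr rfl
    intro i _
    rw [sub_eq_add_neg, expChar_add_left]
    have : (((√(n : ℝ))⁻¹ : ℝ) : ℂ) * (((√(n : ℝ))⁻¹ : ℝ) : ℂ) = (n : ℂ)⁻¹ := by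
      rw [← Complex.ofReal_mul, ← mul_inv, Real.mul_self_sqrt hn'.le]; simp
    rw [← this]; ring
  have hone : mask X 0 = 1 := by
    have : (n : ℂ) ≠ 0 := by exact_mod_cast hn.ne'
    simp [mask, expChar_zero_left, this]
  have hort : Orthonormal ℂ (fun s : F => v s) := by
    rw [orthonormal_iff_ite]
    intro s t
    rw [hin]
    split_ifs with hst
    · rw [hst, sub_self, hone]
    · exact h s s.2 t t.2 (fun h' => hst (Subtype.ext h'))
  have hnorm : ‖v (-ξ)‖ ^ 2 = 1 := by
    have h1 : inner ℂ (v (-ξ)) (v (-ξ)) = (1 : ℂ) := by rw [hin, sub_self, hone]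
    rw [← inner_self_eq_norm_sq (𝕜 := ℂ), h1]; simp
  have := hort.sum_inner_products_le (v (-ξ)) (s := Finset.univ)
  rw [hnorm] at this
  simp_rw [hin] at this
  rw [← Finset.sum_coe_sort F]
  simp_rw [sub_neg_eq_add, add_comm _ ξ] at this
  exact this

/-- Finite Bessel inequality with a set of levels. -/
lemma level_bessel {p : ℕ} (hp : 0 < p) (D : Fin p → (Fin 2 → ℝ)) (b : Fin 2 → ℝ)
    (S : Finset ℕ) (F : Finset (Fin 2 → ℝ))
    (h : ∀ s ∈ F, ∀ t ∈ F, s ≠ t → ∃ k ∈ S, mask D (sc b k (s - t)) = 0) (ξ : Fin 2 → ℝ) :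
    ∑ s ∈ F, ‖∏ k ∈ S, mask D (sc b k (ξ + s))‖ ^ 2 ≤ 1 := by
  obtain ⟨n, X, hn, hX⟩ := mask_prod_rep hp D b S
  simp_rw [← hX]
  apply mask_bessel hn
  intro s hs t ht hst
  obtain ⟨k, hk, hk0⟩ := h s hs t ht hst
  rw [hX]
  exact Finset.prod_eq_zero hk hk0

lemma cos_bound (δ θ : ℝ) (hδ : 0 ≤ δ) (h : ∀ n : ℤ, δ ≤ |θ - n|) :
    Real.cos (2 * Real.pi * θ) ≤ 1 - 8 * δ ^ 2 := by
  set t := θ - round θ with ht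
  have h1 : |t| ≤ 1 / 2 := abs_sub_round θ
  have h2 : δ ≤ |t| := h (round θ)
  have h3 : Real.cos (2 * Real.pi * θ) = Real.cos (2 * Real.pi * t) := by
    rw [show 2 * Real.pi * t = 2 * Real.pi * θ - (round θ : ℤ) * (2 * Real.pi) by rw [ht]; ring,
      Real.cos_sub_int_mul_two_pi]
  rw [h3]
  have hpi := Real.pi_pos
  have h4 : |2 * Real.pi * t| ≤ Real.pi := by
    rw [abs_mul, abs_of_pos (by positivity)]; nlinarith
  have := Real.cos_le_one_sub_mul_cos_sq h4
  have h5 : δ ^ 2 ≤ t ^ 2 := by rw [← sq_abs t]; gcongr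
  have h6 : 2 / Real.pi ^ 2 * (2 * Real.pi * t) ^ 2 = 8 * t ^ 2 := by field_simp; ring
  linarith

lemma expChar_re (ξ x : Fin 2 → ℝ) :
    (expChar ξ x).re = Real.cos (2 * Real.pi * (ξ 0 * x 0 + ξ 1 * x 1)) := by
  unfold expChar
  rw [show (-2 * Real.pi * Complex.I) * ((ξ 0 * x 0 + ξ 1 * x 1 : ℝ) : ℂ)
    = ((-(2 * Real.pi * (ξ 0 * x 0 + ξ 1 * x 1)) : ℝ) : ℂ) * Complex.I by push_cast; ring,
    Complex.exp_ofReal_mul_I_re, Real.cos_neg]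

lemma mask_core {p : ℕ} (hp : 0 < p) (D : Fin p → (Fin 2 → ℝ)) (i0 j : Fin p) (hij : i0 ≠ j)
    (h0 : D i0 = 0) (δ : ℝ) (hδ : 0 ≤ δ) (ξ : Fin 2 → ℝ)
    (h : ∀ n : ℤ, δ ≤ |(ξ 0 * D j 0 + ξ 1 * D j 1) - n|) :
    ‖mask D ξ‖ ≤ 1 - 4 * δ ^ 2 / p := by
  have hp' : (0 : ℝ) < p := by exact_mod_cast hp
  have hδ2 : δ ≤ 1 / 2 := (h _).trans (abs_sub_round _)
  unfold mask
  rw [norm_mul, norm_inv, Complex.norm_natCast, inv_mul_le_iff₀ hp']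
  have h1 : ‖expChar ξ (D i0) + expChar ξ (D j)‖ ≤ 2 - 4 * δ ^ 2 := by
    rw [h0, expChar_zero_right]
    have hsq : ‖1 + expChar ξ (D j)‖ ^ 2 ≤ (2 - 4 * δ ^ 2) ^ 2 := by
      have hn : ‖expChar ξ (D j)‖ ^ 2 = 1 := by rw [expChar_norm]; norm_num
      rw [Complex.sq_norm, Complex.normSq_apply] at hn ⊢
      have hc := cos_bound δ _ hδ h
      rw [← expChar_re] at hc
      simp only [Complex.add_re, Complex.one_re, Complex.add_im, Complex.one_im]
      nlinarith [sq_nonneg (δ ^ 2)]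
    exact le_of_sq_le_sq hsq (by nlinarith)
  have hsum : ∑ i, expChar ξ (D i) = (expChar ξ (D i0) + expChar ξ (D j)) +
      ∑ i ∈ (Finset.univ.erase i0).erase j, expChar ξ (D i) := by
    rw [← Finset.add_sum_erase _ _ (Finset.mem_univ i0),
      ← Finset.add_sum_erase (Finset.univ.erase i0) _
        (Finset.mem_erase.2 ⟨hij.symm, Finset.mem_univ j⟩)]
    ring
  have h2 : ‖∑ i ∈ (Finset.univ.erase i0).erase j, expChar ξ (D i)‖ ≤ (p : ℝ) - 2 := by
    refine (norm_sum_le _ _).trans ?_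
    simp only [expChar_norm, Finset.sum_const, nsmul_eq_mul, mul_one]
    rw [Finset.card_erase_of_mem (Finset.mem_erase.2 ⟨hij.symm, Finset.mem_univ j⟩),
      Finset.card_erase_of_mem (Finset.mem_univ i0), Finset.card_univ, Fintype.card_fin]
    have : 2 ≤ p := by
      have h3 : (i0 : ℕ) ≠ j := fun h => hij (Fin.ext h)
      have := i0.2; have := j.2
      omega
    rw [Nat.sub_sub, Nat.cast_sub this]; norm_num
  rw [hsum]
  have := norm_add_le (expChar ξ (D i0) + expChar ξ (D j))
    (∑ i ∈ (Finset.univ.erase i0).erase j, expChar ξ (D i))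
  have h7 : (p : ℝ) * (1 - 4 * δ ^ 2 / p) = p - 4 * δ ^ 2 := by field_simp
  rw [h7]; linarith

/-- Uniform non-peaking of the mask away from integers, in coordinate `i`. -/
def EtaCond {p : ℕ} (D : Fin p → (Fin 2 → ℝ)) (i : Fin 2) : Prop :=
  ∃ A : ℤ, A ≠ 0 ∧ ∀ δ : ℝ, 0 < δ → ∃ η : ℝ, 0 ≤ η ∧ η < 1 ∧
    ∀ ξ : Fin 2 → ℝ, (∀ n : ℤ, δ ≤ |A * ξ i - n|) → ‖mask D ξ‖ ≤ η

lemma eta_zero (p : ℕ) (hp : p.Prime) (D : Fin p → (Fin 2 → ℤ)) (h l : ℤ)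
    (hD0 : D ⟨0, hp.pos⟩ = 0)
    (hD11 : D ⟨1, hp.one_lt⟩ 1 = 0) (hD10 : D ⟨1, hp.one_lt⟩ 0 ≠ 0)
    (Dt : Fin p → (Fin 2 → ℝ))
    (hDt : ∀ i, Dt i = ![(D i 0 : ℝ) + ((h : ℝ) / l) * (D i 1 : ℝ), (D i 1 : ℝ)]) :
    EtaCond Dt 0 := by
  have hp' : (0 : ℝ) < p := by exact_mod_cast hp.pos
  refine ⟨D ⟨1, hp.one_lt⟩ 0, hD10, fun δ hδ => ⟨max 0 (1 - 4 * δ ^ 2 / p), le_max_left _ _,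
    max_lt one_pos (by have : 0 < 4 * δ ^ 2 / p := by positivity
                       linarith), fun ξ hξ => le_max_of_le_right ?_⟩⟩
  refine mask_core hp.pos Dt ⟨0, hp.pos⟩ ⟨1, hp.one_lt⟩ (by simp) ?_ δ hδ.le ξ ?_
  · rw [hDt, hD0]; ext i; fin_cases i <;> simp
  · intro n
    have := hξ n
    rw [hDt, hD11]
    simpa [mul_comm] using this

lemma eta_one (p : ℕ) (hp : p.Prime) (D : Fin p → (Fin 2 → ℤ)) (h l : ℤ) (hl : l ≠ 0)
    (a : Fin 2 → ℤ) (hZ : ZeroSetCond p D a)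
    (hD0 : D ⟨0, hp.pos⟩ = 0)
    (hD11 : D ⟨1, hp.one_lt⟩ 1 = 0) (hD10 : D ⟨1, hp.one_lt⟩ 0 ≠ 0)
    (Dt : Fin p → (Fin 2 → ℝ))
    (hDt : ∀ i, Dt i = ![(D i 0 : ℝ) + ((h : ℝ) / l) * (D i 1 : ℝ), (D i 1 : ℝ)]) :
    EtaCond Dt 1 := by
  have hp' : (0 : ℝ) < p := by exact_mod_cast hp.pos
  have hl' : (l : ℝ) ≠ 0 := by exact_mod_cast hl
  have hex : ∃ j, D j 1 ≠ 0 := by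
    by_contra! hno
    have h1 : mask (digitR D) ![(a 0 : ℝ) / p, (a 1 : ℝ) / p] = 0 := by
      rw [hZ.2]
      refine ⟨1, le_rfl, by have := hp.two_le; omega, 0, fun i => ?_⟩
      fin_cases i <;> simp
    have h2 : mask (digitR D) ![(a 0 : ℝ) / p, 1 / (2 * p)] = 0 := by
      rw [← h1]
      unfold mask expChar digitR
      simp [hno]
    rw [hZ.2] at h2
    obtain ⟨j, -, -, k, hk⟩ := h2
    have h3 := hk 1
    simp only [Matrix.cons_val_one, Matrix.cons_val_fin_one] at h3
    field_simp at h3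
    have h4 : (1 : ℤ) = 2 * (j * a 1 + k 1 * p) := by
      have : (1 : ℝ) = 2 * (j * a 1 + k 1 * p) := by linarith
      exact_mod_cast this
    omega
  obtain ⟨j, hj⟩ := hex
  set d := D ⟨1, hp.one_lt⟩ 0 with hd
  have hDt0 : Dt ⟨0, hp.pos⟩ = 0 := by
    rw [hDt, hD0]; ext i; fin_cases i <;> simp
  have hj0 : (⟨0, hp.pos⟩ : Fin p) ≠ j := by
    rintro rfl; rw [hD0] at hj; simp at hj
  refine ⟨l * d * D j 1, by simp [hl, hD10, hj], fun δ hδ => ?_⟩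
  set C : ℝ := |(l * d : ℝ)| + |(l * D j 0 + h * D j 1 : ℝ)| + 1 with hC
  have hCpos : 0 < C := by positivity
  set δ' := δ / C with hδ'
  have hδ'0 : 0 < δ' := by positivity
  refine ⟨max 0 (1 - 4 * δ' ^ 2 / p), le_max_left _ _,
    max_lt one_pos (by have : 0 < 4 * δ' ^ 2 / p := by positivity
                       linarith), fun ξ hξ => le_max_of_le_right ?_⟩
  by_cases hA : ∀ n : ℤ, δ' ≤ |(ξ 0 * Dt j 0 + ξ 1 * Dt j 1) - n|
  · exact mask_core hp.pos Dt _ j hj0 hDt0 δ' hδ'0.le ξ hA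
  by_cases hB : ∀ n : ℤ, δ' ≤ |(ξ 0 * Dt ⟨1, hp.one_lt⟩ 0 + ξ 1 * Dt ⟨1, hp.one_lt⟩ 1) - n|
  · exact mask_core hp.pos Dt _ ⟨1, hp.one_lt⟩ (by simp) hDt0 δ' hδ'0.le ξ hB
  exfalso
  push Not at hA hB
  obtain ⟨n, hn⟩ := hA
  obtain ⟨m, hm⟩ := hB
  rw [hDt] at hn hm
  simp only [hD11, Matrix.cons_val_zero, Matrix.cons_val_one, Matrix.cons_val_fin_one, ← hd] at hn hm
  set u := ξ 0 * (↑(D j 0) + ↑h / ↑l * ↑(D j 1)) + ξ 1 * ↑(D j 1) - (n : ℝ) with hu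
  set w := ξ 0 * (↑d + ↑h / ↑l * ((0 : ℤ) : ℝ)) + ξ 1 * ((0 : ℤ) : ℝ) - (m : ℝ) with hw
  have key : ((l * d * D j 1 : ℤ) : ℝ) * ξ 1 - ((l * d * n - (l * D j 0 + h * D j 1) * m : ℤ) : ℝ)
      = (l * d : ℝ) * u - (l * D j 0 + h * D j 1 : ℝ) * w := by
    rw [hu, hw]; push_cast; field_simp; ring
  have h1 := hξ (l * d * n - (l * D j 0 + h * D j 1) * m)
  rw [key] at h1
  have h2 : |(l * d : ℝ) * u - (l * D j 0 + h * D j 1 : ℝ) * w|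
      ≤ |(l * d : ℝ) * u| + |(l * D j 0 + h * D j 1 : ℝ) * w| := by
    have := abs_add_le ((l * d : ℝ) * u) (-((l * D j 0 + h * D j 1 : ℝ) * w))
    rwa [abs_neg, ← sub_eq_add_neg] at this
  rw [abs_mul (l * d : ℝ) u, abs_mul (l * D j 0 + h * D j 1 : ℝ) w] at h2
  have h3 : |(l * d : ℝ)| * |u| ≤ |(l * d : ℝ)| * δ' := by gcongr
  have h4 : |(l * D j 0 + h * D j 1 : ℝ)| * |w| ≤ |(l * D j 0 + h * D j 1 : ℝ)| * δ' := by gcongr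
  have h5 : C * δ' = δ := by rw [hδ']; field_simp
  have h6 : C * δ' = |(l * d : ℝ)| * δ' + |(l * D j 0 + h * D j 1 : ℝ)| * δ' + δ' := by
    rw [hC]; ring
  linarith

/-- Level arithmetic. -/
lemma level_arith (p : ℕ) (hp : p.Prime) (D : Fin p → (Fin 2 → ℤ)) (h l : ℤ) (hl : l ≠ 0)
    (a : Fin 2 → ℤ) (hZ : ZeroSetCond p D a) (hla : ¬ (p : ℤ) ∣ (l * a 1 - h * a 0))
    (Dt : Fin p → (Fin 2 → ℝ))
    (hDt : ∀ i, Dt i = ![(D i 0 : ℝ) + ((h : ℝ) / l) * (D i 1 : ℝ), (D i 1 : ℝ)])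
    (ξ : Fin 2 → ℝ) (hξ : mask Dt ξ = 0) :
    (∃ m : ℤ, (p : ℝ) * ξ 0 = m ∧ ¬ (p : ℤ) ∣ m) ∧
    (∃ m : ℤ, (p * l : ℝ) * ξ 1 = m ∧ ¬ (p : ℤ) ∣ m) := by
  have hp' : (p : ℝ) ≠ 0 := by exact_mod_cast hp.ne_zero
  have hl' : (l : ℝ) ≠ 0 := by exact_mod_cast hl
  have h1 : mask (digitR D) ![ξ 0, (h : ℝ) / l * ξ 0 + ξ 1] = 0 := by
    rw [← hξ]
    unfold mask expChar digitR
    congr 1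
    apply Finset.sum_congr rfl
    intro i _
    congr 3
    rw [hDt]
    simp
    ring
  rw [hZ.2] at h1
  obtain ⟨j, hj1, hj2, k, hk⟩ := h1
  have hpi : Prime (p : ℤ) := Nat.prime_iff_prime_int.1 hp
  have hj : ¬ (p : ℤ) ∣ (j : ℤ) := by
    intro hd
    have := Nat.le_of_dvd (by omega) (Int.natCast_dvd_natCast.1 hd)
    have := hp.two_le
    omega
  have ha0 : ¬ (p : ℤ) ∣ a 0 := by
    intro hd
    have := Int.le_of_dvd (by have := hZ.1 0; omega) hd
    have := hZ.1 0; omega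
  have hk0 := hk 0
  have hk1 := hk 1
  simp only [Matrix.cons_val_zero, Matrix.cons_val_one, Matrix.cons_val_fin_one] at hk0 hk1
  constructor
  · refine ⟨j * a 0 + p * k 0, ?_, ?_⟩
    · rw [hk0]; push_cast; field_simp
    · intro hd
      rw [Int.dvd_add_left (dvd_mul_right _ _)] at hd
      rcases hpi.dvd_or_dvd hd with h' | h'
      · exact hj h'
      · exact ha0 h'
  · refine ⟨j * (l * a 1 - h * a 0) + p * (l * k 1 - h * k 0), ?_, ?_⟩
    · have : ξ 1 = (j : ℝ) * a 1 / p + k 1 - h / l * (j * a 0 / p + k 0) := by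
        rw [← hk0]; linarith
      rw [this]; push_cast; field_simp; ring
    · intro hd
      rw [Int.dvd_add_left (dvd_mul_right _ _)] at hd
      rcases hpi.dvd_or_dvd hd with h' | h'
      · exact hj h'
      · exact hla h'

lemma level_bessel_sub {p : ℕ} (hp : 0 < p) (D : Fin p → (Fin 2 → ℝ)) (b : Fin 2 → ℝ)
    (Λ : Set (Fin 2 → ℝ)) (S : Finset ℕ) (F : Finset Λ)
    (h : ∀ s ∈ F, ∀ t ∈ F, s ≠ t →
      ∃ k ∈ S, mask D (sc b k ((s : Fin 2 → ℝ) - t)) = 0) (ξ : Fin 2 → ℝ) :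
    ∑ s ∈ F, ‖∏ k ∈ S, mask D (sc b k (ξ + s))‖ ^ 2 ≤ 1 := by
  have := level_bessel hp D b S (F.map (Function.Embedding.subtype _)) ?_ ξ
  · simpa [Finset.sum_map] using this
  · intro s hs t ht hst
    rw [Finset.mem_map] at hs ht
    obtain ⟨s', hs', rfl⟩ := hs
    obtain ⟨t', ht', rfl⟩ := ht
    exact h s' hs' t' ht' (fun e => hst (by rw [e]))

lemma removal {p : ℕ} (hp : 0 < p) (μ : Measure (Fin 2 → ℝ)) (b : Fin 2 → ℝ) (hb : ∀ i, 1 < b i)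
    (D : Fin p → (Fin 2 → ℝ)) (hμ : IsSelfAffine μ !![b 0, 0; 0, b 1] D) (hη : EtaCond D 0)
    (Λ : Set (Fin 2 → ℝ)) (hsum : ∀ ξ, HasSum (fun l : Λ => ‖ftMeasure μ (ξ + l)‖ ^ 2) 1)
    (κ : Λ → Λ → ℕ) (hκ : ∀ s t, s ≠ t → 1 ≤ κ s t ∧
      mask D (sc b (κ s t) ((s : Fin 2 → ℝ) - t)) = 0)
    (k0 : ℕ) (hk0 : 1 ≤ k0) : ∃ s t, s ≠ t ∧ κ s t = k0 := by
  classical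
  by_contra! hno
  have hb0 : ∀ i, b i ≠ 0 := fun i => by have := hb i; positivity
  have hprob := hμ.1
  have hne : Nonempty Λ := by
    by_contra hemp
    rw [not_nonempty_iff] at hemp
    have h1 := hsum 0
    have h2 := h1.unique (hasSum_empty)
    norm_num at h2
  obtain ⟨l0⟩ := hne
  obtain ⟨A, hA, hAη⟩ := hη
  have hA' : (A : ℝ) ≠ 0 := by exact_mod_cast hA
  have hbk : 0 < b 0 ^ k0 := by have := hb 0; positivity
  have hcont : Filter.Tendsto (fun s : ℝ => ftMeasure μ ![s, 0]) (nhds 0) (nhds 1) := by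
    have h1 : Continuous (fun s : ℝ => ftMeasure μ ![s, 0]) := by
      apply (ft_continuous μ).comp
      refine continuous_pi fun i => ?_
      fin_cases i
      · exact continuous_id
      · exact continuous_const
    have h2 := h1.tendsto 0
    rwa [show (![(0 : ℝ), 0] : Fin 2 → ℝ) = 0 by ext i; fin_cases i <;> rfl, ft_zero] at h2
  have he1 : ∀ᶠ s : ℝ in nhdsWithin 0 {0}ᶜ, ftMeasure μ ![s, 0] ≠ 0 :=
    (hcont.eventually_ne one_ne_zero).filter_mono nhdsWithin_le_nhds
  have he2 : ∀ᶠ s : ℝ in nhdsWithin 0 {0}ᶜ, |A * (s / b 0 ^ k0)| < 1 / 2 := by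
    apply Filter.Eventually.filter_mono nhdsWithin_le_nhds
    have : Continuous (fun s : ℝ => |A * (s / b 0 ^ k0)|) := by fun_prop
    have h2 := this.tendsto 0
    simp only [zero_div, mul_zero, abs_zero] at h2
    exact h2.eventually_lt_const (by norm_num)
  obtain ⟨s, ⟨hs1, hs2⟩, hs3⟩ :=
    ((he1.and he2).and (eventually_mem_nhdsWithin (a := (0 : ℝ)) (s := {0}ᶜ))).exists
  have hs0 : s ≠ 0 := hs3
  set v : Fin 2 → ℝ := ![s, 0] with hv
  set δ := |A * (s / b 0 ^ k0)| with hδ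
  have hδ0 : 0 < δ := abs_pos.2 (mul_ne_zero hA' (div_ne_zero hs0 hbk.ne'))
  obtain ⟨η, hη0, hη1, hη2⟩ := hAη δ hδ0
  have hfv : ‖mask D (sc b k0 v)‖ ≤ η := by
    apply hη2
    intro n
    have e : (A : ℝ) * sc b k0 v 0 = A * (s / b 0 ^ k0) := by simp [sc, hv]
    rw [e]
    rcases eq_or_ne n 0 with rfl | hn
    · simp [hδ]
    · have h1 : (1 : ℝ) ≤ |(n : ℝ)| := by exact_mod_cast Int.one_le_abs hn
      have h2 := abs_sub_abs_le_abs_sub (n : ℝ) (A * (s / b 0 ^ k0))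
      rw [abs_sub_comm] at h2
      linarith
  set c := (1 - η ^ 2) * ‖ftMeasure μ v‖ ^ 2 with hc
  have hη2' : η ^ 2 < 1 := by nlinarith
  have hcpos : 0 < c := by
    have : 0 < ‖ftMeasure μ v‖ := norm_pos_iff.2 hs1
    have : 0 < 1 - η ^ 2 := by linarith
    positivity
  set ξ := v - (l0 : Fin 2 → ℝ) with hξ
  have hξl : ξ + l0 = v := by rw [hξ]; simp
  have hF : ∀ F : Finset Λ, l0 ∈ F → ∑ l ∈ F, ‖ftMeasure μ (ξ + l)‖ ^ 2 ≤ 1 - c := by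
    intro F hl0
    set N := k0 + ∑ s ∈ F, ∑ t ∈ F, κ s t with hN
    have hκN : ∀ s ∈ F, ∀ t ∈ F, κ s t ≤ N := by
      intro s hs t ht
      have h1 : κ s t ≤ ∑ t ∈ F, κ s t :=
        Finset.single_le_sum (f := fun t => κ s t) (fun _ _ => Nat.zero_le _) ht
      have h2 : ∑ t ∈ F, κ s t ≤ ∑ s ∈ F, ∑ t ∈ F, κ s t :=
        Finset.single_le_sum (f := fun s => ∑ t ∈ F, κ s t) (fun _ _ => Nat.zero_le _) hs
      omega
    set S := (Finset.Icc 1 N).erase k0 with hS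
    have hB := level_bessel_sub hp D b Λ S F (fun s hs t ht hst =>
      ⟨κ s t, by rw [hS, Finset.mem_erase, Finset.mem_Icc]
                 exact ⟨hno s t hst, (hκ s t hst).1, hκN s hs t ht⟩, (hκ s t hst).2⟩) ξ
    set g : Λ → ℝ := fun l => ‖∏ k ∈ S, mask D (sc b k (ξ + l))‖ ^ 2 with hg
    have hk0N : k0 ∈ Finset.Icc 1 N := by rw [Finset.mem_Icc]; omega
    have hle : ∀ l : Λ, ‖ftMeasure μ (ξ + l)‖ ^ 2 ≤ ‖mask D (sc b k0 (ξ + l))‖ ^ 2 * g l := by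
      intro l
      rw [ft_iter μ b hb0 D hμ _ N, ← Finset.mul_prod_erase _ _ hk0N, ← hS, norm_mul, norm_mul,
        mul_pow, mul_pow]
      have := ft_norm_le μ (sc b N (ξ + l))
      exact mul_le_of_le_one_right (by positivity) (pow_le_one₀ (norm_nonneg _) this)
    have hg0 : ∀ l, 0 ≤ g l := fun l => by positivity
    have hle1 : ∀ l : Λ, ‖ftMeasure μ (ξ + l)‖ ^ 2 ≤ g l := fun l =>
      (hle l).trans (mul_le_of_le_one_left (hg0 l)
        (pow_le_one₀ (norm_nonneg _) (mask_norm_le _ _)))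
    have hle0 : ‖ftMeasure μ (ξ + l0)‖ ^ 2 ≤ η ^ 2 * g l0 := by
      refine (hle l0).trans ?_
      rw [hξl]
      have := hg0 l0
      gcongr
    have hle0' := hle1 l0
    rw [hξl] at hle0'
    rw [← Finset.add_sum_erase _ _ hl0] at hB ⊢
    have h3 : ∑ l ∈ F.erase l0, ‖ftMeasure μ (ξ + l)‖ ^ 2 ≤ ∑ l ∈ F.erase l0, g l :=
      Finset.sum_le_sum fun l _ => hle1 l
    have h4 : c ≤ (1 - η ^ 2) * g l0 := by
      rw [hc]; apply mul_le_mul_of_nonneg_left hle0' (by linarith)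
    have h5 : g l0 + ∑ l ∈ F.erase l0, g l ≤ 1 := hB
    nlinarith
  have h1 : (1 : ℝ) ≤ 1 - c := by
    refine le_of_tendsto (hsum ξ) ?_
    filter_upwards [Filter.eventually_ge_atTop {l0}] with F hF'
    exact hF F (hF' (Finset.mem_singleton_self _))
  linarith

/-- Some scaled copy is far from the integers. -/
lemma far_scale (r q : ℕ) (hq : 2 ≤ q) (hqr : q < r) (hcop : Nat.Coprime r q) (y : ℝ) (J : ℕ)
    (hJ : 1 ≤ J) (hy1 : (r : ℝ) ≤ |y|) (hy2 : 2 * |y| < (r : ℝ) ^ (J - 1)) :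
    ∃ k, 1 ≤ k ∧ k ≤ J ∧ ∀ n : ℤ, 1 / ((r : ℝ) + q) ≤ |y / ((r : ℝ) / q) ^ k - n| := by
  by_contra! hcon
  have hq0 : (0 : ℝ) < q := by have : 0 < q := by omega
                               exact_mod_cast this
  have hq2 : (2 : ℝ) ≤ q := by exact_mod_cast hq
  have hqr' : (q : ℝ) < r := by exact_mod_cast hqr
  have hr0 : (0 : ℝ) < r := by linarith
  have hδ : 1 / ((r : ℝ) + q) ≤ 1 / 2 := by
    apply one_div_le_one_div_of_le <;> linarith
  choose! N hN using hcon
  have hrec : ∀ k, 1 ≤ k → k + 1 ≤ J → (r : ℤ) * N (k + 1) = q * N k := by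
    intro k hk1 hkJ
    have e1 := hN k hk1 (by omega)
    have e2 := hN (k + 1) (by omega) hkJ
    have e3 : (r : ℝ) * (y / ((r : ℝ) / q) ^ (k + 1)) = q * (y / ((r : ℝ) / q) ^ k) := by
      rw [pow_succ]; field_simp
    have e4 : |(r : ℝ) * N (k + 1) - q * N k| < 1 := by
      have : (r : ℝ) * N (k + 1) - q * N k = q * (y / ((r : ℝ) / q) ^ k - N k)
          + -(r * (y / ((r : ℝ) / q) ^ (k + 1) - N (k + 1))) := by
        linear_combination e3
      rw [this]
      refine (abs_add_le _ _).trans_lt ?_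
      rw [abs_neg, abs_mul, abs_mul, abs_of_pos hq0, abs_of_pos hr0]
      have f1 := mul_lt_mul_of_pos_left e1 hq0
      have f2 := mul_lt_mul_of_pos_left e2 hr0
      have f3 : (q : ℝ) * (1 / (r + q)) + r * (1 / (r + q)) = 1 := by field_simp; ring
      linarith
    have e5 : |(r : ℤ) * N (k + 1) - q * N k| < 1 := by exact_mod_cast e4
    have := Int.abs_lt_one_iff.1 e5
    linarith
  have hpow : ∀ j, j + 1 ≤ J → (r : ℤ) ^ j * N (j + 1) = (q : ℤ) ^ j * N 1 := by
    intro j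
    induction j with
    | zero => intro _; simp
    | succ j ih =>
      intro hj
      have h1 := ih (by omega)
      have h2 := hrec (j + 1) (by omega) hj
      rw [pow_succ, pow_succ, mul_assoc, h2]
      linear_combination (q : ℤ) * h1
  have h1 := hpow (J - 1) (by omega)
  have hd : (r : ℤ) ^ (J - 1) ∣ (q : ℤ) ^ (J - 1) * N 1 := ⟨_, h1.symm⟩
  have hcopI : IsCoprime (r : ℤ) (q : ℤ) := Nat.isCoprime_iff_coprime.2 hcop
  have hd' := (IsCoprime.pow (m := J - 1) (n := J - 1) hcopI).dvd_of_dvd_mul_left hd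
  have hN1 := hN 1 le_rfl hJ
  rw [pow_one] at hN1
  have hu1 : 1 ≤ |y / ((r : ℝ) / q)| := by
    rw [abs_div, abs_of_pos (by positivity : (0 : ℝ) < r / q), le_div_iff₀ (by positivity), one_mul]
    refine le_trans ?_ hy1
    exact div_le_self hr0.le (by linarith)
  have hu2 : |y / ((r : ℝ) / q)| ≤ |y| := by
    rw [abs_div, abs_of_pos (by positivity : (0 : ℝ) < r / q)]
    apply div_le_self (abs_nonneg _)
    rw [le_div_iff₀ hq0]; linarith
  have hne : N 1 ≠ 0 := by
    intro h0
    rw [h0] at hN1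
    simp only [Int.cast_zero, sub_zero] at hN1
    linarith
  have hle := Int.le_of_dvd (abs_pos.2 hne) ((dvd_abs _ _).2 hd')
  have hle' : (r : ℝ) ^ (J - 1) ≤ |(N 1 : ℝ)| := by exact_mod_cast hle
  have h3 : |(N 1 : ℝ)| ≤ |y / ((r : ℝ) / q)| + 1 / 2 := by
    have := abs_sub_abs_le_abs_sub (N 1 : ℝ) (y / ((r : ℝ) / q))
    rw [abs_sub_comm] at this
    linarith
  linarith

lemma exists_T (r q : ℕ) (hq : 2 ≤ q) : ∃ T : ℕ, 1 ≤ T ∧ r ≤ q ^ T := by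
  refine ⟨r + 1, by omega, ?_⟩
  have : r + 1 < q ^ (r + 1) := Nat.lt_pow_self (by omega)
  omega

lemma decay {p : ℕ} (μ : Measure (Fin 2 → ℝ)) (b : Fin 2 → ℝ) (hb : ∀ i, 1 < b i)
    (D : Fin p → (Fin 2 → ℝ)) (hμ : IsSelfAffine μ !![b 0, 0; 0, b 1] D) (i : Fin 2)
    (hη : EtaCond D i) (r q : ℕ) (hq : 2 ≤ q) (hqr : q < r) (hcop : Nat.Coprime r q)
    (hbi : b i = (r : ℝ) / q) :
    ∃ (A : ℝ) (E : ℕ) (η : ℝ), 1 ≤ |A| ∧ 2 ≤ E ∧ 0 ≤ η ∧ η < 1 ∧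
      ∀ (n : ℕ) (x : Fin 2 → ℝ), (r : ℝ) ^ (E ^ n) ≤ |A * x i| → ‖ftMeasure μ x‖ ≤ η ^ n := by
  obtain ⟨A, hA, hAη⟩ := hη
  obtain ⟨T, hT1, hT⟩ := exists_T r q hq
  have hprob := hμ.1
  have hb0 : ∀ i, b i ≠ 0 := fun i => by have := hb i; positivity
  have hq0 : (0 : ℝ) < q := by have : 0 < q := by omega
                               exact_mod_cast this
  have hq2 : (2 : ℝ) ≤ q := by exact_mod_cast hq
  have hqr' : (q : ℝ) < r := by exact_mod_cast hqr
  have hr0 : (0 : ℝ) < r := by linarith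
  have hr1 : (1 : ℝ) < r := by linarith
  obtain ⟨η, hη0, hη1, hη2⟩ := hAη (1 / ((r : ℝ) + q)) (by positivity)
  refine ⟨A, 4 * T, η, by exact_mod_cast Int.one_le_abs hA, by omega, hη0, hη1, ?_⟩
  intro n
  induction n with
  | zero => intro x _; simpa using ft_norm_le μ x
  | succ n ih =>
    intro x hx
    set y := (A : ℝ) * x i with hy
    have hE1 : 1 ≤ (4 * T) ^ n := Nat.one_le_pow _ _ (by omega)
    have hE2 : T * ((4 * T) ^ n + 3) ≤ (4 * T) ^ (n + 1) := by
      rw [pow_succ]; nlinarith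
    have hr_y : (r : ℝ) ≤ |y| := by
      refine le_trans ?_ hx
      exact le_self_pow₀ hr1.le (by positivity)
    have hex : ∃ m : ℕ, 2 * |y| < (r : ℝ) ^ m := pow_unbounded_of_one_lt _ hr1
    classical
    set m := Nat.find hex with hm
    have hm1 : 2 * |y| < (r : ℝ) ^ m := Nat.find_spec hex
    have hmpos : (4 * T) ^ (n + 1) < m := by
      by_contra hle
      push Not at hle
      have := pow_le_pow_right₀ hr1.le hle
      linarith [abs_nonneg y]
    have hm2 : (r : ℝ) ^ (m - 1) ≤ 2 * |y| := by
      have := Nat.find_min hex (m := m - 1) (by omega)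
      exact not_lt.1 this
    obtain ⟨k, hk1, hkJ, hk⟩ := far_scale r q hq hqr hcop y (m + 1) (by omega) hr_y (by simpa using hm1)
    have hAx : (A : ℝ) * sc b k x i = y / ((r : ℝ) / q) ^ k := by
      simp only [sc, hbi, hy]; ring
    have hf : ‖mask D (sc b k x)‖ ≤ η := by
      apply hη2; intro z; rw [hAx]; exact hk z
    have hrest : ‖ftMeasure μ (sc b k x)‖ ≤ η ^ n := by
      apply ih
      rw [hAx, abs_div, abs_of_pos (by positivity : (0 : ℝ) < (r / q) ^ k),
        le_div_iff₀ (by positivity)]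
      have h1 : ((r : ℝ) / q) ^ k ≤ ((r : ℝ) / q) ^ (m + 1) := by
        apply pow_le_pow_right₀ _ hkJ
        rw [le_div_iff₀ hq0]; linarith
      have h2 : (r : ℝ) ^ ((4 * T) ^ n + 3) ≤ (q : ℝ) ^ (m + 1) := by
        have h3 : (r : ℝ) ≤ (q : ℝ) ^ T := by exact_mod_cast hT
        calc (r : ℝ) ^ ((4 * T) ^ n + 3) ≤ ((q : ℝ) ^ T) ^ ((4 * T) ^ n + 3) := by gcongr
          _ = (q : ℝ) ^ (T * ((4 * T) ^ n + 3)) := by rw [pow_mul]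
          _ ≤ _ := pow_le_pow_right₀ (by linarith) (by omega)
      have h4 : (r : ℝ) ^ ((4 * T) ^ n) * ((r : ℝ) / q) ^ (m + 1) ≤ (r : ℝ) ^ (m - 1) / r := by
        rw [div_pow, ← mul_div_assoc, div_le_div_iff₀ (by positivity) hr0]
        calc (r : ℝ) ^ ((4 * T) ^ n) * r ^ (m + 1) * r
            = r ^ (m - 1) * r ^ ((4 * T) ^ n + 3) := by
              rw [← pow_add, ← pow_succ, ← pow_add]; congr 1; omega
          _ ≤ _ := by gcongr
      calc _ ≤ (r : ℝ) ^ ((4 * T) ^ n) * ((r : ℝ) / q) ^ (m + 1) := by gcongr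
        _ ≤ (r : ℝ) ^ (m - 1) / r := h4
        _ ≤ 2 * |y| / r := by gcongr
        _ ≤ |y| := by rw [div_le_iff₀ hr0]; nlinarith [abs_nonneg y]
    rw [ft_iter μ b hb0 D hμ x k, norm_mul,
      ← Finset.mul_prod_erase _ _ (Finset.mem_Icc.2 ⟨hk1, le_rfl⟩), norm_mul, norm_prod]
    have h5 : ∏ j ∈ (Finset.Icc 1 k).erase k, ‖mask D (sc b j x)‖ ≤ 1 :=
      Finset.prod_le_one (fun _ _ => norm_nonneg _) (fun _ _ => mask_norm_le _ _)
    have h6 : 0 ≤ ∏ j ∈ (Finset.Icc 1 k).erase k, ‖mask D (sc b j x)‖ :=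
      Finset.prod_nonneg (fun _ _ => norm_nonneg _)
    calc _ ≤ η * 1 * η ^ n := by gcongr
      _ = η ^ (n + 1) := by rw [pow_succ]; ring

lemma dai_step {p : ℕ} (hp : 0 < p) (μ : Measure (Fin 2 → ℝ)) (b : Fin 2 → ℝ) (hb : ∀ i, 1 < b i)
    (D : Fin p → (Fin 2 → ℝ)) (hμ : IsSelfAffine μ !![b 0, 0; 0, b 1] D)
    (Λ : Set (Fin 2 → ℝ)) (κ : Λ → Λ → ℕ) (hκ : ∀ s t, s ≠ t → 1 ≤ κ s t ∧
      mask D (sc b (κ s t) ((s : Fin 2 → ℝ) - t)) = 0)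
    (ξ : Fin 2 → ℝ) (ε : ℝ) (hε : 0 ≤ ε) (G H : Finset Λ) (hGH : G ⊆ H) (K : ℕ)
    (hK : ∀ s ∈ H, ∀ t ∈ H, s ≠ t → κ s t ≤ K)
    (hsmall : ∀ l ∈ H, l ∉ G → ‖ftMeasure μ (sc b K (ξ + l))‖ ^ 2 ≤ ε) :
    (1 - ∑ l ∈ G, ‖ftMeasure μ (ξ + l)‖ ^ 2) * (1 - ε)
      ≤ 1 - ∑ l ∈ H, ‖ftMeasure μ (ξ + l)‖ ^ 2 := by
  classical
  have hprob := hμ.1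
  have hb0 : ∀ i, b i ≠ 0 := fun i => by have := hb i; positivity
  have hB := level_bessel_sub hp D b Λ (Finset.Icc 1 K) H (fun s hs t ht hst =>
      ⟨κ s t, by rw [Finset.mem_Icc]
                 exact ⟨(hκ s t hst).1, hK s hs t ht hst⟩, (hκ s t hst).2⟩) ξ
  have heq : ∀ l : Λ, ‖ftMeasure μ (ξ + l)‖ ^ 2 =
      ‖∏ k ∈ Finset.Icc 1 K, mask D (sc b k (ξ + l))‖ ^ 2 * ‖ftMeasure μ (sc b K (ξ + l))‖ ^ 2 := by
    intro l
    rw [ft_iter μ b hb0 D hμ _ K, norm_mul, mul_pow]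
  set g : Λ → ℝ := fun l => ‖∏ k ∈ Finset.Icc 1 K, mask D (sc b k (ξ + l))‖ ^ 2 with hg
  have hg0 : ∀ l, 0 ≤ g l := fun l => by positivity
  have h1 : ∑ l ∈ H \ G, ‖ftMeasure μ (ξ + l)‖ ^ 2 ≤ ∑ l ∈ H \ G, g l * ε := by
    apply Finset.sum_le_sum
    intro l hl
    rw [Finset.mem_sdiff] at hl
    rw [heq l]
    exact mul_le_mul_of_nonneg_left (hsmall l hl.1 hl.2) (hg0 l)
  have h2 : ∑ l ∈ G, ‖ftMeasure μ (ξ + l)‖ ^ 2 ≤ ∑ l ∈ G, g l := by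
    apply Finset.sum_le_sum
    intro l _
    rw [heq l]
    exact mul_le_of_le_one_right (hg0 l) (pow_le_one₀ (norm_nonneg _) (ft_norm_le _ _))
  have h3 : ∑ l ∈ H \ G, g l + ∑ l ∈ G, g l ≤ 1 := by
    rw [Finset.sum_sdiff hGH]; exact hB
  rw [← Finset.sum_mul] at h1
  rw [← Finset.sum_sdiff hGH]
  nlinarith

lemma dai_core {I : Type*} (a : I → ℕ → ℝ) (ha0 : ∀ F k, 0 ≤ a F k) (T E C : ℕ)
    (hE : 1 ≤ E) (θ : ℝ) (hθ0 : 0 ≤ θ) (hθ1 : θ < 1)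
    (hstep : ∀ F n j, 2 * T ≤ j → a F (j * ((1 + C) * E ^ n)) * (1 - θ ^ n)
      ≤ a F ((j + 1) * ((1 + C) * E ^ n))) :
    ∃ n0 : ℕ, ∀ F m, a F (2 * T * ((1 + C) * E ^ n0)) / 2
      ≤ a F (2 * T * ((1 + C) * E ^ (n0 + m))) := by
  set W : ℕ := 2 * T * (E - 1) with hW
  have hθn : ∀ n : ℕ, θ ^ n ≤ 1 := fun n => pow_le_one₀ hθ0 hθ1.le
  have hθn0 : ∀ n : ℕ, 0 ≤ θ ^ n := fun n => pow_nonneg hθ0 n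
  have hmulti : ∀ F n, a F (2 * T * ((1 + C) * E ^ n)) * (1 - W * θ ^ n)
      ≤ a F (2 * T * ((1 + C) * E ^ (n + 1))) := by
    intro F n
    have h1 : ∀ i : ℕ, a F (2 * T * ((1 + C) * E ^ n)) * (1 - i * θ ^ n)
        ≤ a F ((2 * T + i) * ((1 + C) * E ^ n)) := by
      intro i
      induction i with
      | zero => simp
      | succ i ih =>
        refine le_trans ?_ (hstep F n (2 * T + i) (by omega))
        have h2 := mul_le_mul_of_nonneg_right ih (by linarith [hθn n] : 0 ≤ 1 - θ ^ n)
        refine le_trans ?_ h2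
        rw [mul_assoc (a F _)]
        apply mul_le_mul_of_nonneg_left _ (ha0 _ _)
        push_cast
        have : 0 ≤ (i : ℝ) * θ ^ n * θ ^ n := by have := hθn0 n; positivity
        nlinarith
    have h2 := h1 W
    have e : (2 * T + W) * ((1 + C) * E ^ n) = 2 * T * ((1 + C) * E ^ (n + 1)) := by
      obtain ⟨e, rfl⟩ : ∃ e, E = e + 1 := ⟨E - 1, by omega⟩
      rw [hW, pow_succ]; simp only [Nat.add_sub_cancel]; ring
    rwa [e] at h2
  obtain ⟨n0, hn0⟩ : ∃ n0 : ℕ, W * θ ^ n0 / (1 - θ) ≤ 1 / 2 := by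
    have h1 := ((tendsto_pow_atTop_nhds_zero_of_lt_one hθ0 hθ1).const_mul (W : ℝ)).div_const (1 - θ)
    simp only [mul_zero, zero_div] at h1
    exact (h1.eventually_le_const (by norm_num : (0 : ℝ) < 1 / 2)).exists
  refine ⟨n0, fun F m => ?_⟩
  have hpos : 0 < 1 - θ := by linarith
  have key : ∀ m : ℕ, a F (2 * T * ((1 + C) * E ^ n0)) * (1 - ∑ j ∈ Finset.range m, W * θ ^ (n0 + j))
      ≤ a F (2 * T * ((1 + C) * E ^ (n0 + m))) := by
    have hs : ∀ m : ℕ, ∑ j ∈ Finset.range m, (W : ℝ) * θ ^ (n0 + j) ≤ 1 / 2 := by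
      intro m
      refine le_trans ?_ hn0
      rw [le_div_iff₀ hpos]
      simp_rw [pow_add, ← mul_assoc]
      rw [← Finset.mul_sum, mul_assoc]
      apply mul_le_of_le_one_right
      · have := hθn0 n0; positivity
      · rw [geom_sum_mul_neg]; linarith [hθn0 m]
    intro m
    induction m with
    | zero => simp
    | succ m ih =>
      rw [Finset.sum_range_succ]
      have h1 := hmulti F (n0 + m)
      have h2 := hs (m + 1)
      rw [Finset.sum_range_succ] at h2
      set S := ∑ j ∈ Finset.range m, (W : ℝ) * θ ^ (n0 + j)
      set w := (W : ℝ) * θ ^ (n0 + m)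
      have hw : 0 ≤ w := by have := hθn0 (n0 + m); positivity
      have hS : 0 ≤ S := Finset.sum_nonneg fun j _ => by have := hθn0 (n0 + j); positivity
      have h3 := mul_le_mul_of_nonneg_right ih (by linarith : 0 ≤ 1 - w)
      refine le_trans ?_ (le_trans h3 h1)
      rw [mul_assoc (a F _)]
      apply mul_le_mul_of_nonneg_left _ (ha0 _ _)
      nlinarith
  have hs : ∑ j ∈ Finset.range m, (W : ℝ) * θ ^ (n0 + j) ≤ 1 / 2 := by
    refine le_trans ?_ hn0
    rw [le_div_iff₀ hpos]
    simp_rw [pow_add, ← mul_assoc]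
    rw [← Finset.mul_sum, mul_assoc]
    apply mul_le_of_le_one_right
    · have := hθn0 n0; positivity
    · rw [geom_sum_mul_neg]; linarith [hθn0 m]
  refine le_trans ?_ (key m)
  rw [div_eq_mul_inv]
  apply mul_le_mul_of_nonneg_left _ (ha0 _ _)
  linarith

lemma dai_contra {p : ℕ} (hp : 0 < p) (μ : Measure (Fin 2 → ℝ)) (b : Fin 2 → ℝ)
    (hb : ∀ i, 1 < b i)
    (D : Fin p → (Fin 2 → ℝ)) (hμ : IsSelfAffine μ !![b 0, 0; 0, b 1] D) (i : Fin 2)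
    (hη : EtaCond D i) (r q : ℕ) (hq : 2 ≤ q) (hqr : q < r) (hcop : Nat.Coprime r q)
    (hbi : b i = (r : ℝ) / q)
    (Λ : Set (Fin 2 → ℝ)) (hsum : ∀ ξ, HasSum (fun l : Λ => ‖ftMeasure μ (ξ + l)‖ ^ 2) 1)
    (κ : Λ → Λ → ℕ) (hκ : ∀ s t, s ≠ t → 1 ≤ κ s t ∧
      mask D (sc b (κ s t) ((s : Fin 2 → ℝ) - t)) = 0)
    (h2 : ∀ k, 1 ≤ k → ∃ s t, s ≠ t ∧ κ s t = k)
    (c : ℝ) (hc : 1 ≤ |c|) (y : Λ → ℝ) (hy : ∀ l : Λ, y l = c * (l : Fin 2 → ℝ) i)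
    (hsep : ∀ s t, s ≠ t → (r : ℝ) ^ κ s t / q ≤ |y s - y t|)
    (hnz : ∀ x, ∃ ξ : Fin 2 → ℝ, |ξ i| ≤ 1 ∧ ftMeasure μ (ξ + x) ≠ 0) : False := by
  classical
  obtain ⟨A, E, η, hA, hE, hη0, hη1, hdec⟩ := decay μ b hb D hμ i hη r q hq hqr hcop hbi
  obtain ⟨T, hT1, hT⟩ := exists_T r q hq
  have hprob := hμ.1
  have hq0 : (0 : ℝ) < q := by have : 0 < q := by omega
                               exact_mod_cast this
  have hq2 : (2 : ℝ) ≤ q := by exact_mod_cast hq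
  have hqr' : (q : ℝ) < r := by exact_mod_cast hqr
  have hr0 : (0 : ℝ) < r := by linarith
  have hr1 : (1 : ℝ) < r := by linarith
  have hcpos : 0 < |c| := by linarith
  obtain ⟨C, hC⟩ : ∃ C : ℕ, 4 * |c| < (r : ℝ) ^ C := pow_unbounded_of_one_lt _ hr1
  have hlev : ∀ k s t, s ≠ t → |y s| < (r : ℝ) ^ k / 2 → |y t| < (r : ℝ) ^ k / 2 → κ s t ≤ k := by
    intro k s t hst hs ht
    have h1 := hsep s t hst
    have h3 : |y s - y t| ≤ |y s| + |y t| := by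
      have := abs_add_le (y s) (-(y t))
      rwa [abs_neg, ← sub_eq_add_neg] at this
    have h4 : (r : ℝ) ^ κ s t / q < r ^ k := by linarith
    rw [div_lt_iff₀ hq0] at h4
    have h5 : (r : ℝ) ^ κ s t < r ^ (k + 1) := by
      rw [pow_succ]
      exact h4.trans (by gcongr)
    have := (pow_lt_pow_iff_right₀ hr1).1 h5
    omega
  let I := Finset Λ × {ξ : Fin 2 → ℝ // |ξ i| ≤ 1}
  let a : I → ℕ → ℝ := fun P k => 1 - ∑ l ∈ P.1.filter (fun l => |y l| < (r : ℝ) ^ k / 2),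
    ‖ftMeasure μ (P.2.1 + l)‖ ^ 2
  have hfin : ∀ (ξ : Fin 2 → ℝ) (F : Finset Λ), ∑ l ∈ F, ‖ftMeasure μ (ξ + l)‖ ^ 2 ≤ 1 :=
    fun ξ F => sum_le_hasSum F (fun _ _ => by positivity) (hsum ξ)
  have ha0 : ∀ P k, 0 ≤ a P k := fun P k => sub_nonneg.2 (hfin _ _)
  have hθ1 : η ^ 2 < 1 := by nlinarith
  have hstep : ∀ (P : I) n j, 2 * T ≤ j → a P (j * ((1 + C) * E ^ n)) * (1 - (η ^ 2) ^ n)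
      ≤ a P ((j + 1) * ((1 + C) * E ^ n)) := by
    rintro ⟨F, ξ, hξ⟩ n j hj
    set w := (1 + C) * E ^ n with hw
    have hEn : 1 ≤ E ^ n := Nat.one_le_pow _ _ (by omega)
    have hw1 : E ^ n + C ≤ w := by rw [hw]; nlinarith
    set k := j * w with hk
    have hK : (j + 1) * w = k + w := by rw [hk]; ring
    rw [hK]
    have hkC : C ≤ k := by
      have : w ≤ k := by rw [hk]; exact Nat.le_mul_of_pos_left _ (by omega)
      omega
    have hmono : (r : ℝ) ^ k ≤ r ^ (k + w) := pow_le_pow_right₀ hr1.le (by omega)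
    refine dai_step hp μ b hb D hμ Λ κ hκ ξ _ (by positivity) _ _ ?_ (k + w) ?_ ?_
    · intro l hl
      rw [Finset.mem_filter] at hl ⊢
      exact ⟨hl.1, by linarith [hl.2]⟩
    · intro s hs t ht hst
      rw [Finset.mem_filter] at hs ht
      exact hlev _ s t hst hs.2 ht.2
    · intro l hl hlG
      rw [Finset.mem_filter] at hl hlG
      have hyl : (r : ℝ) ^ k / 2 ≤ |y l| := by
        by_contra hlt
        exact hlG ⟨hl.1, not_le.1 hlt⟩
      rw [← pow_mul, mul_comm 2 n, pow_mul]
      refine pow_le_pow_left₀ (norm_nonneg _) ?_ 2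
      apply hdec
      rw [hy, abs_mul] at hyl
      have h4 : (r : ℝ) ^ k ≤ |ξ i + (l : Fin 2 → ℝ) i| * r ^ C := by
        have h5 : |(l : Fin 2 → ℝ) i| ≤ |ξ i + (l : Fin 2 → ℝ) i| + |ξ i| := by
          have := abs_add_le (ξ i + (l : Fin 2 → ℝ) i) (-(ξ i))
          rwa [abs_neg, add_neg_cancel_comm] at this
        have h6 : (r : ℝ) ^ C ≤ r ^ k := pow_le_pow_right₀ hr1.le hkC
        have h7 : |c| * |(l : Fin 2 → ℝ) i| ≤ |c| * (|ξ i + (l : Fin 2 → ℝ) i| + 1) := by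
          gcongr; linarith
        have h8 : |ξ i + (l : Fin 2 → ℝ) i| * (4 * |c|) ≤ |ξ i + (l : Fin 2 → ℝ) i| * r ^ C := by
          gcongr
        linarith
      have h9 : (r : ℝ) ^ (E ^ n + C + w) ≤ (q : ℝ) ^ (k + w) := by
        have h3 : (r : ℝ) ≤ (q : ℝ) ^ T := by exact_mod_cast hT
        calc (r : ℝ) ^ (E ^ n + C + w) ≤ ((q : ℝ) ^ T) ^ (E ^ n + C + w) := by gcongr
          _ = (q : ℝ) ^ (T * (E ^ n + C + w)) := by rw [pow_mul]
          _ ≤ _ := by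
            apply pow_le_pow_right₀ (by linarith)
            rw [← hK]
            calc T * (E ^ n + C + w) ≤ T * (2 * w) := Nat.mul_le_mul_left _ (by omega)
              _ = 2 * T * w := by ring
              _ ≤ (j + 1) * w := Nat.mul_le_mul_right _ (by omega)
      have e1 : A * sc b (k + w) (ξ + l) i = A * ((ξ i + (l : Fin 2 → ℝ) i) * q ^ (k + w) / r ^ (k + w)) := by
        simp only [sc, hbi, Pi.add_apply, div_pow]
        field_simp
      rw [e1, abs_mul]
      refine le_trans ?_ (le_mul_of_one_le_left (abs_nonneg _) hA)
      rw [abs_div, abs_mul, abs_of_pos (by positivity : (0 : ℝ) < q ^ (k + w)),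
        abs_of_pos (by positivity : (0 : ℝ) < r ^ (k + w)), le_div_iff₀ (by positivity)]
      have hrC : (0 : ℝ) < r ^ C := by positivity
      refine le_of_mul_le_mul_right ?_ hrC
      calc (r : ℝ) ^ E ^ n * r ^ (k + w) * r ^ C = r ^ k * r ^ (E ^ n + C + w) := by
            rw [← pow_add, ← pow_add, ← pow_add]; congr 1; ring
        _ ≤ (|ξ i + (l : Fin 2 → ℝ) i| * r ^ C) * (q : ℝ) ^ (k + w) := by gcongr
        _ = _ := by ring
  obtain ⟨n0, hn0⟩ := dai_core a ha0 T E C (by omega) (η ^ 2) (by positivity) hθ1 hstep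
  set k0 := 2 * T * ((1 + C) * E ^ n0) with hk0
  obtain ⟨l0, hl0⟩ : ∃ l : Λ, (r : ℝ) ^ k0 / 2 ≤ |y l| := by
    by_contra! hcon
    obtain ⟨s, t, hst, hk⟩ := h2 (k0 + 1) (by omega)
    have := hlev k0 s t hst (hcon s) (hcon t)
    omega
  obtain ⟨ξ, hξ1, hξ2⟩ := hnz l0
  have hpos : 0 < ‖ftMeasure μ (ξ + l0)‖ ^ 2 := by
    have := norm_pos_iff.2 hξ2
    positivity
  have hunb : ∀ F : Finset Λ, ∑ l ∈ F, ‖ftMeasure μ (ξ + l)‖ ^ 2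
      ≤ 1 - ‖ftMeasure μ (ξ + l0)‖ ^ 2 / 2 := by
    intro F
    obtain ⟨M, hM⟩ : ∃ M : ℕ, 2 * ∑ l ∈ F, |y l| < (r : ℝ) ^ M := pow_unbounded_of_one_lt _ hr1
    have h3 := hn0 (F, ⟨ξ, hξ1⟩) M
    set K := 2 * T * ((1 + C) * E ^ (n0 + M)) with hK
    have hMK : M ≤ K := by
      have e1 : M < E ^ M := Nat.lt_pow_self (by omega)
      have e2 : E ^ M ≤ E ^ (n0 + M) := Nat.pow_le_pow_right (by omega) (by omega)
      have e3 : E ^ (n0 + M) ≤ (1 + C) * E ^ (n0 + M) := Nat.le_mul_of_pos_left _ (by omega)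
      have e4 : (1 + C) * E ^ (n0 + M) ≤ K := Nat.le_mul_of_pos_left _ (by omega)
      omega
    have hFK : F.filter (fun l => |y l| < (r : ℝ) ^ K / 2) = F := by
      rw [Finset.filter_eq_self]
      intro l hl
      have e1 : |y l| ≤ ∑ l ∈ F, |y l| :=
        Finset.single_le_sum (f := fun l => |y l|) (fun _ _ => abs_nonneg _) hl
      have e2 : (r : ℝ) ^ M ≤ r ^ K := pow_le_pow_right₀ hr1.le hMK
      linarith
    have e1 : a (F, ⟨ξ, hξ1⟩) K = 1 - ∑ l ∈ F, ‖ftMeasure μ (ξ + l)‖ ^ 2 := by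
      simp only [a, hFK]
    have e2 : ‖ftMeasure μ (ξ + l0)‖ ^ 2 ≤ a (F, ⟨ξ, hξ1⟩) k0 := by
      have hnot : l0 ∉ F.filter (fun l => |y l| < (r : ℝ) ^ k0 / 2) := by
        rw [Finset.mem_filter]
        rintro ⟨-, h⟩
        linarith
      have := hfin ξ (insert l0 (F.filter (fun l => |y l| < (r : ℝ) ^ k0 / 2)))
      rw [Finset.sum_insert hnot] at this
      simp only [a]
      linarith
    linarith
  have h1 := le_of_tendsto' (hsum ξ) hunb
  linarith

lemma exists_nonzero (p : ℕ) (hp : p.Prime) (μ : Measure (Fin 2 → ℝ)) (b : Fin 2 → ℝ)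
    (hb : ∀ i, 1 < b i)
    (D : Fin p → (Fin 2 → ℝ)) (hμ : IsSelfAffine μ !![b 0, 0; 0, b 1] D)
    (h0 : ∀ ξ, mask D ξ = 0 → ∃ m : ℤ, (p : ℝ) * ξ 0 = m) (i : Fin 2) (x : Fin 2 → ℝ) :
    ∃ ξ : Fin 2 → ℝ, |ξ i| ≤ 1 ∧ ftMeasure μ (ξ + x) ≠ 0 := by
  have hp' : (p : ℝ) ≠ 0 := by exact_mod_cast hp.ne_zero
  set S : Set ℝ := Set.range (fun z : ℕ × ℤ => (z.2 : ℝ) / p * b 0 ^ z.1 - x 0) with hS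
  have hSc : S.Countable := Set.countable_range _
  have : ∃ t ∈ Set.Ioo (0 : ℝ) 1, t ∉ S := by
    by_contra! hcon
    have h1 : (Set.Ioo (0 : ℝ) 1).Countable := hSc.mono hcon
    exact (Cardinal.Real.Ioo_countable_iff.1 h1).not_gt (by norm_num)
  obtain ⟨t, ht, htS⟩ := this
  refine ⟨![t, 0], ?_, ?_⟩
  · fin_cases i
    · simp only [Fin.zero_eta, Matrix.cons_val_zero]
      rw [abs_le]; exact ⟨by linarith [ht.1], ht.2.le⟩
    · simp
  · intro hz
    obtain ⟨k, -, hk⟩ := ft_eq_zero μ b hb D hμ _ hz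
    obtain ⟨m, hm⟩ := h0 _ hk
    apply htS
    refine ⟨(k, m), ?_⟩
    have hbk : b 0 ^ k ≠ 0 := by have := hb 0; positivity
    simp only [sc, Pi.add_apply, Matrix.cons_val_zero] at hm
    simp only [← hm]
    field_simp
    ring

lemma coord_int (p : ℕ) (hp : p.Prime) (μ : Measure (Fin 2 → ℝ)) (b : Fin 2 → ℝ)
    (hb : ∀ i, 1 < b i)
    (D : Fin p → (Fin 2 → ℝ)) (hμ : IsSelfAffine μ !![b 0, 0; 0, b 1] D) (i : Fin 2)
    (hη : EtaCond D i)
    (Λ : Set (Fin 2 → ℝ)) (hsum : ∀ ξ, HasSum (fun l : Λ => ‖ftMeasure μ (ξ + l)‖ ^ 2) 1)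
    (κ : Λ → Λ → ℕ) (hκ : ∀ s t, s ≠ t → 1 ≤ κ s t ∧
      mask D (sc b (κ s t) ((s : Fin 2 → ℝ) - t)) = 0)
    (h2 : ∀ k, 1 ≤ k → ∃ s t, s ≠ t ∧ κ s t = k)
    (h0 : ∀ ξ, mask D ξ = 0 → ∃ m : ℤ, (p : ℝ) * ξ 0 = m)
    (c : ℝ) (hc : 1 ≤ |c|)
    (hcm : ∀ ξ, mask D ξ = 0 → ∃ m : ℤ, c * ξ i = m ∧ ¬ (p : ℤ) ∣ m) :
    ∃ n : ℤ, (p : ℤ) ∣ n ∧ b i = (n : ℝ) := by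
  have hex : ∀ s t : Λ, ∃ m : ℤ, s ≠ t →
      c * sc b (κ s t) ((s : Fin 2 → ℝ) - t) i = m ∧ ¬ (p : ℤ) ∣ m := by
    intro s t
    by_cases hst : s = t
    · exact ⟨0, fun h => absurd hst h⟩
    · obtain ⟨m, hm⟩ := hcm _ (hκ s t hst).2
      exact ⟨m, fun _ => hm⟩
  choose m hm using hex
  have hbpos : 0 < b i := by linarith [hb i]
  have h1 : ∀ s t : Λ, s ≠ t → c * (s : Fin 2 → ℝ) i - c * (t : Fin 2 → ℝ) i
      = b i ^ κ s t * m s t ∧ ¬ (p : ℤ) ∣ m s t ∧ 1 ≤ κ s t := by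
    intro s t hst
    refine ⟨?_, (hm s t hst).2, (hκ s t hst).1⟩
    rw [← (hm s t hst).1]
    simp only [sc, Pi.sub_apply]
    field_simp
  obtain ⟨r, q, hq1, hqr, hpr, hcop, hbi, hdvd⟩ := nt_main p hp (b i) (hb i)
    (fun l : Λ => c * (l : Fin 2 → ℝ) i) κ m h1 h2
  rcases Nat.lt_or_ge 1 q with hq | hq
  · exfalso
    have hq0 : (0 : ℝ) < q := by exact_mod_cast hq1
    have hr0 : (0 : ℝ) < r := by
      have : 0 < r := by omega
      exact_mod_cast this
    refine dai_contra hp.pos μ b hb D hμ i hη r q hq hqr hcop hbi Λ hsum κ hκ h2 c hc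
      (fun l => c * (l : Fin 2 → ℝ) i) (fun _ => rfl) ?_ (exists_nonzero p hp μ b hb D hμ h0 i)
    intro s t hst
    have e := h1 s t hst
    rw [e.1, abs_mul, abs_of_pos (by positivity)]
    have hne : m s t ≠ 0 := by
      intro h; apply e.2.1; rw [h]; exact dvd_zero _
    have hle := Int.le_of_dvd (abs_pos.2 hne) ((dvd_abs _ _).2 (hdvd s t hst))
    have hle' : (q : ℝ) ^ (κ s t - 1) ≤ |(m s t : ℝ)| := by exact_mod_cast hle
    rw [hbi]
    obtain ⟨k, hk⟩ : ∃ k, κ s t = k + 1 := ⟨κ s t - 1, by have := e.2.2; omega⟩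
    rw [hk] at hle' ⊢
    simp only [Nat.add_sub_cancel] at hle'
    calc (r : ℝ) ^ (k + 1) / q = ((r : ℝ) / q) ^ (k + 1) * q ^ k := by
          rw [div_pow, pow_succ (q : ℝ) k]; field_simp
      _ ≤ _ := by gcongr
  · have : q = 1 := by omega
    subst this
    exact ⟨r, by exact_mod_cast hpr, by rw [hbi]; simp⟩

lemma main_aux (p : ℕ) (hp : p.Prime) (D : Fin p → (Fin 2 → ℤ)) (h l : ℤ) (hl : l ≠ 0)
    (a : Fin 2 → ℤ) (hZ : ZeroSetCond p D a) (hla : ¬ (p : ℤ) ∣ (l * a 1 - h * a 0))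
    (hD0 : D ⟨0, hp.pos⟩ = 0)
    (hD11 : D ⟨1, hp.one_lt⟩ 1 = 0) (hD10 : D ⟨1, hp.one_lt⟩ 0 ≠ 0)
    (Dt : Fin p → (Fin 2 → ℝ))
    (hDt : ∀ i, Dt i = ![(D i 0 : ℝ) + ((h : ℝ) / l) * (D i 1 : ℝ), (D i 1 : ℝ)])
    (μ : Measure (Fin 2 → ℝ)) (b : Fin 2 → ℝ) (hb : ∀ i, 1 < b i)
    (hμ : IsSelfAffine μ !![b 0, 0; 0, b 1] Dt) (hspec : IsSpectral μ) :
    (∃ n : ℤ, (p : ℤ) ∣ n ∧ b 0 = (n : ℝ)) ∧ (∃ n : ℤ, (p : ℤ) ∣ n ∧ b 1 = (n : ℝ)) := by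
  have hprob := hμ.1
  obtain ⟨Λ, -, horth, hsum⟩ := spectral_facts μ hspec
  have hη0 := eta_zero p hp D h l hD0 hD11 hD10 Dt hDt
  have hη1 := eta_one p hp D h l hl a hZ hD0 hD11 hD10 Dt hDt
  have hlev := level_arith p hp D h l hl a hZ hla Dt hDt
  have hex : ∀ s t : Λ, ∃ k : ℕ, s ≠ t → 1 ≤ k ∧ mask Dt (sc b k ((s : Fin 2 → ℝ) - t)) = 0 := by
    intro s t
    by_cases hst : s = t
    · exact ⟨0, fun h => absurd hst h⟩
    · obtain ⟨k, hk⟩ := ft_eq_zero μ b hb Dt hμ _ (horth s t hst)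
      exact ⟨k, fun _ => hk⟩
  choose κ hκ using hex
  have h2 : ∀ k, 1 ≤ k → ∃ s t, s ≠ t ∧ κ s t = k := fun k hk =>
    removal hp.pos μ b hb Dt hμ hη0 Λ hsum κ hκ k hk
  have h0 : ∀ ξ, mask Dt ξ = 0 → ∃ m : ℤ, (p : ℝ) * ξ 0 = m := by
    intro ξ hξ
    obtain ⟨m, hm, -⟩ := (hlev ξ hξ).1
    exact ⟨m, hm⟩
  have hp1 : (1 : ℝ) ≤ p := by exact_mod_cast hp.one_lt.le
  have hl1 : (1 : ℝ) ≤ |(l : ℝ)| := by exact_mod_cast Int.one_le_abs hl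
  constructor
  · exact coord_int p hp μ b hb Dt hμ 0 hη0 Λ hsum κ hκ h2 h0 p
      (by rwa [abs_of_nonneg (by linarith)]) (fun ξ hξ => (hlev ξ hξ).1)
  · exact coord_int p hp μ b hb Dt hμ 1 hη1 Λ hsum κ hκ h2 h0 (p * l)
      (by rw [abs_mul, abs_of_nonneg (by linarith : (0 : ℝ) ≤ p)]; nlinarith)
      (fun ξ hξ => (hlev ξ hξ).2)

/-- Proposition 5.1: with `ρ₁ ≠ ρ₂` and `c'' ∈ E_a`, if `μ_{M̃,D̃}` is a spectral measure
then `ρ₁⁻¹, ρ₂⁻¹ ∈ pℤ`. -/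
theorem stmt14 (p : ℕ) (hp : p.Prime) (ρ₁ ρ₂ c : ℝ)
    (hρ10 : 0 < ρ₁) (hρ11 : ρ₁ < 1) (hρ20 : 0 < ρ₂) (hρ21 : ρ₂ < 1) (hρ : ρ₁ ≠ ρ₂)
    (D : Fin p → (Fin 2 → ℤ)) (hD : Function.Injective D)
    (a : Fin 2 → ℤ) (hZ : ZeroSetCond p D a)
    (hD0 : D ⟨0, hp.pos⟩ = 0)
    (hD11 : D ⟨1, hp.one_lt⟩ 1 = 0) (hD10 : D ⟨1, hp.one_lt⟩ 0 ≠ 0)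
    (hE : c / (ρ₁⁻¹ - ρ₂⁻¹) ∈ Ea p a)
    (Mt : Matrix (Fin 2) (Fin 2) ℝ) (hMt : Mt = !![ρ₁⁻¹, 0; 0, ρ₂⁻¹])
    (Dt : Fin p → (Fin 2 → ℝ))
    (hDt : ∀ i, Dt i = ![(D i 0 : ℝ) + (c / (ρ₁⁻¹ - ρ₂⁻¹)) * (D i 1 : ℝ), (D i 1 : ℝ)])
    (μt : Measure (Fin 2 → ℝ)) (hμt : IsSelfAffine μt Mt Dt)
    (hspec : IsSpectral μt) :
    (∃ n₁ : ℤ, (p : ℤ) ∣ n₁ ∧ ρ₁⁻¹ = (n₁ : ℝ)) ∧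
      (∃ n₂ : ℤ, (p : ℤ) ∣ n₂ ∧ ρ₂⁻¹ = (n₂ : ℝ)) := by
  have hEx : ∃ h l : ℤ, l ≠ 0 ∧ ¬ (p : ℤ) ∣ (l * a 1 - h * a 0) ∧
      c / (ρ₁⁻¹ - ρ₂⁻¹) = (h : ℝ) / l := by
    have hzero : c / (ρ₁⁻¹ - ρ₂⁻¹) = 0 → ∃ h l : ℤ, l ≠ 0 ∧ ¬ (p : ℤ) ∣ (l * a 1 - h * a 0) ∧
        c / (ρ₁⁻¹ - ρ₂⁻¹) = (h : ℝ) / l := by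
      intro h0
      refine ⟨0, 1, one_ne_zero, ?_, by rw [h0]; simp⟩
      intro hd
      have h1 := hZ.1 1
      have := Int.le_of_dvd (by omega) hd
      omega
    rcases hE with ⟨h, l, -, hla, hx⟩ | hx
    · by_cases hl : l = 0
      · apply hzero; rw [hx, hl]; simp
      · exact ⟨h, l, hl, hla, hx⟩
    · exact hzero hx
  obtain ⟨h, l, hl, hla, hx⟩ := hEx
  rw [hx] at hDt
  rw [hMt] at hμt
  refine main_aux p hp D h l hl a hZ hla hD0 hD11 hD10 Dt hDt μt ![ρ₁⁻¹, ρ₂⁻¹] ?_ ?_ hspec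
  · intro i
    fin_cases i
    · exact (one_lt_inv₀ hρ10).2 hρ11
    · exact (one_lt_inv₀ hρ20).2 hρ21
  · exact hμt

end
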